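/- Suppose rectangular diagrams of links R₂ and R₃ are related by a chain of elementary moves containing no type I stabilizations and no type I destabilizations. Let R₂' be obtained from R₂ and R₃' be obtained from R₃ by chains of elementary moves consisting only of type I stabilizations, such that for each oriented type t ∈ {→I, ←I} and each component number i, the two chains contain the same number of stabilizations of oriented type t performed on the component number i. Then R₂' and R₃' are related by a chain of elementary moves containing no type I stabilizations and no type I destabilizations. -/

import Mathlib

open scoped Real

noncomputable section

namespace RectDiag

instance : DecidableEq Real.Angle := Classical.decEq _

/-- The torus `T² = S¹ × S¹` with angular coordinates `(θ, φ)`. -/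
abbrev Torus := Real.Angle × Real.Angle

/-- The length of the arc running from `x` to `y` in the positive direction. -/
def arcLen (x y : Real.Angle) : ℝ :=
  if (y - x).toReal < 0 then (y - x).toReal + 2 * Real.pi else (y - x).toReal

/-- The closed arc `[x;y]` running from `x` to `y` in the positive direction. -/
def Arc (x y : Real.Angle) : Set Real.Angle :=
  {z | ∃ t : ℝ, 0 ≤ t ∧ t ≤ arcLen x y ∧ z = x + (t : Real.Angle)}

/-- The open arc `(x;y)`, the interior of `[x;y]`. -/
def ArcInt (x y : Real.Angle) : Set Real.Angle :=
  {z | ∃ t : ℝ, 0 < t ∧ t < arcLen x y ∧ z = x + (t : Real.Angle)}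

/-- Every meridian `{θ}×S¹` contains no or exactly two points of `V`, of opposite signs. -/
def MeridianOK (V : Finset Torus) (sgn : Torus → Bool) : Prop :=
  ∀ θ : Real.Angle, (∀ v ∈ V, v.1 ≠ θ) ∨
    ∃ u w, u ∈ V ∧ w ∈ V ∧ u ≠ w ∧ u.1 = θ ∧ w.1 = θ ∧ sgn u ≠ sgn w ∧
      ∀ x ∈ V, x.1 = θ → x = u ∨ x = w

/-- Every longitude `S¹×{φ}` contains no or exactly two points of `V`, of opposite signs. -/
def LongitudeOK (V : Finset Torus) (sgn : Torus → Bool) : Prop :=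
  ∀ φ : Real.Angle, (∀ v ∈ V, v.2 ≠ φ) ∨
    ∃ u w, u ∈ V ∧ w ∈ V ∧ u ≠ w ∧ u.2 = φ ∧ w.2 = φ ∧ sgn u ≠ sgn w ∧
      ∀ x ∈ V, x.2 = φ → x = u ∨ x = w

/-- `V` with sign assignment `sgn` satisfies the conditions of a rectangular diagram. -/
def IsDiagSet (V : Finset Torus) (sgn : Torus → Bool) : Prop :=
  MeridianOK V sgn ∧ LongitudeOK V sgn

/-- `S` is a connected component of `V`: a minimal nonempty subset of `V` that is itself a
rectangular diagram of a link (with the inherited signs). -/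
def IsComponent (V : Finset Torus) (sgn : Torus → Bool) (S : Finset Torus) : Prop :=
  S ⊆ V ∧ S.Nonempty ∧ IsDiagSet S sgn ∧
    ∀ S' ⊆ S, S'.Nonempty → IsDiagSet S' sgn → S' = S

/-- An oriented rectangular diagram of a link with numbered connected components:
a finite subset of the torus with a sign assignment satisfying the meridian/longitude
conditions, together with a numbering of the vertices which is constant exactly on
connected components. -/
structure RectDiagram where
  verts : Finset Torus
  sgn : Torus → Bool
  comp : Torus → ℕ
  diag : IsDiagSet verts sgn
  comp_eq_iff : ∀ u ∈ verts, ∀ v ∈ verts,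
    (comp u = comp v ↔ ∃ S, IsComponent verts sgn S ∧ u ∈ S ∧ v ∈ S)

/-- `{u,v}` is a (vertical or horizontal) edge of the diagram `R`. -/
def IsEdge (R : RectDiagram) (u v : Torus) : Prop :=
  u ∈ R.verts ∧ v ∈ R.verts ∧ u ≠ v ∧ (u.1 = v.1 ∨ u.2 = v.2)

/-- The four corner points `{θ₁,θ₂}×{φ₁,φ₂}`. -/
def corners (t1 t2 p1 p2 : Real.Angle) : Finset Torus :=
  {(t1, p1), (t1, p2), (t2, p1), (t2, p2)}

/-- The rectangle `[θ₁;θ₂]×[φ₁;φ₂] ⊆ T²`. -/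
def RectSet (t1 t2 p1 p2 : Real.Angle) : Set Torus :=
  {p | p.1 ∈ Arc t1 t2 ∧ p.2 ∈ Arc p1 p2}

/-- `R₁ ↦ R₂` is an elementary move associated with the rectangle `[θ₁;θ₂]×[φ₁;φ₂]`. -/
def IsElemMoveWith (R₁ R₂ : RectDiagram) (t1 t2 p1 p2 : Real.Angle) : Prop :=
  t1 ≠ t2 ∧ p1 ≠ p2 ∧
  symmDiff R₁.verts R₂.verts = corners t1 t2 p1 p2 ∧
  (∃ u v : Torus, u ∈ symmDiff R₁.verts R₂.verts ∧ v ∈ symmDiff R₁.verts R₂.verts ∧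
      (IsEdge R₁ u v ∨ IsEdge R₂ u v)) ∧
  ¬ R₁.verts ⊆ R₂.verts ∧ ¬ R₂.verts ⊆ R₁.verts ∧
  RectSet t1 t2 p1 p2 ∩ (↑R₁.verts ∪ ↑R₂.verts) = ↑(corners t1 t2 p1 p2) ∧
  ∀ v ∈ R₁.verts ∩ R₂.verts, R₁.sgn v = R₂.sgn v ∧ R₁.comp v = R₂.comp v

/-- `R₁ ↦ R₂` is an elementary move. -/
def IsElemMove (R₁ R₂ : RectDiagram) : Prop :=
  ∃ t1 t2 p1 p2 : Real.Angle, IsElemMoveWith R₁ R₂ t1 t2 p1 p2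

/-- An exchange move. -/
def IsExchange (R₁ R₂ : RectDiagram) : Prop :=
  IsElemMove R₁ R₂ ∧ R₂.verts.card = R₁.verts.card

/-- A stabilization. -/
def IsStab (R₁ R₂ : RectDiagram) : Prop :=
  IsElemMove R₁ R₂ ∧ R₂.verts.card = R₁.verts.card + 2

/-- A destabilization. -/
def IsDestab (R₁ R₂ : RectDiagram) : Prop :=
  IsElemMove R₁ R₂ ∧ R₁.verts.card = R₂.verts.card + 2

/-- A stabilization associated with a given rectangle. -/
def IsStabWith (R₁ R₂ : RectDiagram) (t1 t2 p1 p2 : Real.Angle) : Prop :=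
  IsElemMoveWith R₁ R₂ t1 t2 p1 p2 ∧ R₂.verts.card = R₁.verts.card + 2

/-- The type I corner condition: `R₁ ∩ V ⊆ {(θ₁,φ₁),(θ₂,φ₂)}`. -/
def TypeICornerCond (R₁ : RectDiagram) (t1 t2 p1 p2 : Real.Angle) : Prop :=
  ∀ v ∈ R₁.verts, v ∈ corners t1 t2 p1 p2 → v = (t1, p1) ∨ v = (t2, p2)

/-- The type II corner condition: `R₁ ∩ V ⊆ {(θ₁,φ₂),(θ₂,φ₁)}`. -/
def TypeIICornerCond (R₁ : RectDiagram) (t1 t2 p1 p2 : Real.Angle) : Prop :=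
  ∀ v ∈ R₁.verts, v ∈ corners t1 t2 p1 p2 → v = (t1, p2) ∨ v = (t2, p1)

/-- `R₁ ↦ R₂` is a type I stabilization. -/
def IsTypeIStab (R₁ R₂ : RectDiagram) : Prop :=
  ∃ t1 t2 p1 p2, IsStabWith R₁ R₂ t1 t2 p1 p2 ∧ TypeICornerCond R₁ t1 t2 p1 p2

/-- `R₁ ↦ R₂` is a type II stabilization. -/
def IsTypeIIStab (R₁ R₂ : RectDiagram) : Prop :=
  ∃ t1 t2 p1 p2, IsStabWith R₁ R₂ t1 t2 p1 p2 ∧ TypeIICornerCond R₁ t1 t2 p1 p2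

/-- `R₁ ↦ R₂` is a type I destabilization. -/
def IsTypeIDestab (R₁ R₂ : RectDiagram) : Prop := IsTypeIStab R₂ R₁

/-- `R₁ ↦ R₂` is a type II destabilization. -/
def IsTypeIIDestab (R₁ R₂ : RectDiagram) : Prop := IsTypeIIStab R₂ R₁

/-- The four oriented types `→I`, `←I`, `→II`, `←II` of (de)stabilizations. -/
inductive OType
  | posI
  | negI
  | posII
  | negII
deriving DecidableEq

/-- Whether an oriented type is of (unoriented) type I. -/
def OType.isI : OType → Bool
  | .posI => true
  | .negI => true
  | _ => false

/-- `R₁ ↦ R₂` is a stabilization of the given oriented type. -/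
def IsStabOfOType (R₁ R₂ : RectDiagram) (t : OType) : Prop :=
  ∃ t1 t2 p1 p2, IsStabWith R₁ R₂ t1 t2 p1 p2 ∧
    ∃ p0, (p0 = p1 ∨ p0 = p2) ∧ (t1, p0) ∈ R₂.verts ∧ (t2, p0) ∈ R₂.verts ∧
      (match t with
        | .posI => TypeICornerCond R₁ t1 t2 p1 p2 ∧ R₂.sgn (t2, p0) = true
        | .negI => TypeICornerCond R₁ t1 t2 p1 p2 ∧ R₂.sgn (t2, p0) = false
        | .posII => TypeIICornerCond R₁ t1 t2 p1 p2 ∧ R₂.sgn (t2, p0) = true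
        | .negII => TypeIICornerCond R₁ t1 t2 p1 p2 ∧ R₂.sgn (t2, p0) = false)

/-- `R₁ ↦ R₂` is a destabilization of the given oriented type. -/
def IsDestabOfOType (R₁ R₂ : RectDiagram) (t : OType) : Prop := IsStabOfOType R₂ R₁ t

/-- The move `R₁ ↦ R₂` is performed on (modifies) the connected component number `i`. -/
def ModifiesComp (R₁ R₂ : RectDiagram) (i : ℕ) : Prop :=
  ∃ v ∈ R₁.verts, v ∉ R₂.verts ∧ R₁.comp v = i

/-- The kind of an elementary move: an exchange, a stabilization of oriented type `t`
on the component number `i`, or a destabilization of oriented type `t` on the component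
number `i`. -/
inductive MoveKind
  | exchange
  | stab (t : OType) (i : ℕ)
  | destab (t : OType) (i : ℕ)
deriving DecidableEq

/-- The pair `(R₁, R₂)` is an elementary move realizing the given kind. -/
def KindOk (R₁ R₂ : RectDiagram) : MoveKind → Prop
  | .exchange => IsExchange R₁ R₂
  | .stab t i => IsStabOfOType R₁ R₂ t ∧ ModifiesComp R₁ R₂ i
  | .destab t i => IsDestabOfOType R₁ R₂ t ∧ ModifiesComp R₁ R₂ i

/-- `LChain R s R'` : `s` is a chain of elementary moves from `R` to `R'`, each move
labeled by its kind. -/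
def LChain : RectDiagram → List (MoveKind × RectDiagram) → RectDiagram → Prop
  | R, [], R' => R = R'
  | R, (k, S) :: rest, R' => KindOk R S k ∧ LChain S rest R'


/-- An elementary move that is neither a type I stabilization nor a type I
destabilization. -/
def MoveNoI (R₁ R₂ : RectDiagram) : Prop :=
  IsElemMove R₁ R₂ ∧ ¬ IsTypeIStab R₁ R₂ ∧ ¬ IsTypeIDestab R₁ R₂

section Arcs

theorem arcLen_nonneg (x y : Real.Angle) : 0 ≤ arcLen x y := by
  unfold arcLen
  split_ifs with h
  · linarith [(y - x).neg_pi_lt_toReal, Real.pi_pos]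
  · linarith

theorem arcLen_lt (x y : Real.Angle) : arcLen x y < 2 * π := by
  unfold arcLen
  split_ifs with h
  · linarith
  · linarith [(y - x).toReal_le_pi, Real.pi_pos]

theorem add_arcLen (x y : Real.Angle) : x + (arcLen x y : Real.Angle) = y := by
  unfold arcLen
  split_ifs with h <;> simp [Real.Angle.coe_toReal]

theorem eq_of_coe_eq {s t : ℝ} (hs : 0 ≤ s) (hs' : s < 2 * π) (ht : 0 ≤ t) (ht' : t < 2 * π)
    (h : (s : Real.Angle) = t) : s = t := by
  rw [Real.Angle.angle_eq_iff_two_pi_dvd_sub] at h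
  obtain ⟨k, hk⟩ := h
  have hp := Real.pi_pos
  have h1 : (k : ℝ) < 1 := by nlinarith
  have h2 : (-1 : ℝ) < k := by nlinarith
  have h3 : k = 0 := by
    have : k < 1 := by exact_mod_cast h1
    have : -1 < k := by exact_mod_cast h2
    omega
  subst h3
  simp at hk
  linarith

theorem arcLen_add (x : Real.Angle) {t : ℝ} (ht : 0 ≤ t) (ht' : t < 2 * π) :
    arcLen x (x + t) = t := by
  apply eq_of_coe_eq (arcLen_nonneg _ _) (arcLen_lt _ _) ht ht'
  have := add_arcLen x (x + t)
  exact add_left_cancel this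

theorem mem_Arc {x y z : Real.Angle} : z ∈ Arc x y ↔ arcLen x z ≤ arcLen x y := by
  constructor
  · rintro ⟨t, h0, h1, rfl⟩
    rwa [arcLen_add x h0 (h1.trans_lt (arcLen_lt _ _))]
  · intro h
    exact ⟨arcLen x z, arcLen_nonneg _ _, h, (add_arcLen x z).symm⟩

theorem arcLen_inj {x y z : Real.Angle} : arcLen x y = arcLen x z ↔ y = z := by
  constructor
  · intro h
    rw [← add_arcLen x y, h, add_arcLen]
  · rintro rfl; rfl

theorem arcLen_self (x : Real.Angle) : arcLen x x = 0 := by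
  have := arcLen_add x (t := 0) le_rfl (by linarith [Real.pi_pos])
  simpa using this

/-- The length of `[y;z]` in terms of the positions of `y` and `z` seen from a base point `x`. -/
theorem arcLen_base (x y z : Real.Angle) :
    arcLen y z = if arcLen x y ≤ arcLen x z then arcLen x z - arcLen x y
      else arcLen x z - arcLen x y + 2 * π := by
  have h1 := arcLen_nonneg x y
  have h2 := arcLen_nonneg x z
  have h3 := arcLen_lt x y
  have h4 := arcLen_lt x z
  have hy := add_arcLen x y
  have hz := add_arcLen x z
  set p := arcLen x y
  set q := arcLen x z
  have key : z - y = ((q - p : ℝ) : Real.Angle) := by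
    rw [← hy, ← hz]; simp
  apply eq_of_coe_eq (arcLen_nonneg _ _) (arcLen_lt _ _)
  · split_ifs <;> linarith
  · split_ifs <;> linarith
  · have : (arcLen y z : Real.Angle) = z - y := by
      rw [eq_sub_iff_add_eq, add_comm, add_arcLen]
    rw [this, key]
    split_ifs <;> simp

/-- The arc running from `a` to `c` in the positive direction if `s = true`, and in the
negative direction otherwise. -/
def sArc (s : Bool) (a c : Real.Angle) : Set Real.Angle :=
  if s then Arc a c else Arc c a

theorem left_mem_sArc (s : Bool) (a c : Real.Angle) : a ∈ sArc s a c := by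
  cases s <;> simp [sArc, mem_Arc, arcLen_self, arcLen_nonneg]

theorem right_mem_sArc (s : Bool) (a c : Real.Angle) : c ∈ sArc s a c := by
  cases s <;> simp [sArc, mem_Arc, arcLen_self, arcLen_nonneg]

theorem mem_sArc_total (s : Bool) (a c c' : Real.Angle) :
    c' ∈ sArc s a c ∨ c ∈ sArc s a c' := by
  have h1 := arcLen_nonneg a c
  have h2 := arcLen_nonneg a c'
  have h3 := arcLen_lt a c
  have h4 := arcLen_lt a c'
  have e1 : arcLen a c = arcLen a a ↔ c = a := arcLen_inj
  have e2 : arcLen a c' = arcLen a a ↔ c' = a := arcLen_inj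
  cases s
  · simp only [sArc, mem_Arc, Bool.false_eq_true, if_false, arcLen_base a c, arcLen_base a c',
      arcLen_self] at *
    by_contra! h
    split_ifs at h <;> grind
  · simp only [sArc, mem_Arc, if_true] at *
    exact le_total _ _

theorem sArc_subset_left {s : Bool} {a c c' x : Real.Angle} (h : c' ∈ sArc s a c)
    (hx : x ∈ sArc s a c') : x ∈ sArc s a c := by
  have h2 := arcLen_nonneg a c'
  have h1 := arcLen_nonneg a c
  have h6 := arcLen_nonneg a x
  have h3 := arcLen_lt a c
  have h4 := arcLen_lt a c'
  have h5 := arcLen_lt a x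
  cases s
  · simp only [sArc, mem_Arc, Bool.false_eq_true, if_false, arcLen_base a c, arcLen_base a c',
      arcLen_self] at *
    grind
  · simp only [sArc, mem_Arc, if_true] at *
    exact hx.trans h

theorem sArc_subset_right {s : Bool} {a c c' x : Real.Angle} (h : c' ∈ sArc s a c)
    (hx : x ∈ sArc s c' c) : x ∈ sArc s a c := by
  have h2 := arcLen_nonneg a c'
  have h1 := arcLen_nonneg a c
  have h6 := arcLen_nonneg a x
  have h3 := arcLen_lt a c
  have h4 := arcLen_lt a c'
  have h5 := arcLen_lt a x
  cases s <;>
  · simp only [sArc, mem_Arc, Bool.false_eq_true, if_false, if_true, arcLen_base a c,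
      arcLen_base a c', arcLen_self] at *
    grind

theorem left_notMem_sArc {s : Bool} {a c c' : Real.Angle} (h : c' ∈ sArc s a c) (hc' : c' ≠ a) :
    a ∉ sArc s c' c := by
  intro hx
  have h2 := arcLen_nonneg a c'
  have h1 := arcLen_nonneg a c
  have h3 := arcLen_lt a c
  have h4 := arcLen_lt a c'
  have e2 : arcLen a c' = arcLen a a ↔ c' = a := arcLen_inj
  cases s <;>
  · simp only [sArc, mem_Arc, Bool.false_eq_true, if_false, if_true, arcLen_base a c,
      arcLen_base a c', arcLen_self] at *
    grind

theorem mem_sArc_not {s : Bool} {a c c' : Real.Angle} (h : c' ∈ sArc s a c) (hc' : c' ≠ a) :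
    c ∈ sArc (!s) a c' := by
  have h2 := arcLen_nonneg a c'
  have h1 := arcLen_nonneg a c
  have h3 := arcLen_lt a c
  have h4 := arcLen_lt a c'
  have e2 : arcLen a c' = arcLen a a ↔ c' = a := arcLen_inj
  cases s <;>
  · simp only [sArc, mem_Arc, Bool.false_eq_true, Bool.not_true, Bool.not_false, if_false, if_true,
      arcLen_base a c, arcLen_base a c', arcLen_self] at *
    grind

/-- `c` lies next to `a` on the side `s`, as seen by the finite set `F`. -/
structure Near (s : Bool) (F : Finset Real.Angle) (a c : Real.Angle) : Prop where
  notMem : c ∉ F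
  ne : c ≠ a
  arc : ∀ f ∈ F, f ∈ sArc s a c → f = a

theorem exists_near (s : Bool) (F : Finset Real.Angle) (a : Real.Angle) : ∃ c, Near s F a c := by
  have hp := Real.pi_pos
  have ev : ∀ᶠ t : ℝ in nhdsWithin 0 (Set.Ioi 0), (0 < t ∧ t < 2 * π) ∧
      ∀ f ∈ F, f ≠ a → t < arcLen a f ∧ t < 2 * π - arcLen a f := by
    refine Filter.Eventually.and (Ioo_mem_nhdsGT (by positivity)) ?_
    rw [Filter.eventually_all_finset]
    intro f _
    by_cases hf : f = a
    · simp [hf]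
    · have h0 : 0 < arcLen a f := by
        refine lt_of_le_of_ne (arcLen_nonneg _ _) fun h => hf ?_
        rw [← arcLen_inj (x := a), ← h, arcLen_self]
      have h1 : 0 < 2 * π - arcLen a f := by linarith [arcLen_lt a f]
      filter_upwards [Ioo_mem_nhdsGT h0, Ioo_mem_nhdsGT h1] with t ht ht' _
      exact ⟨ht.2, ht'.2⟩
  obtain ⟨t, ⟨ht, ht'⟩, hF⟩ := ev.exists
  set u : ℝ := if s then t else 2 * π - t with hu
  have hu0 : 0 < u := by rw [hu]; split_ifs <;> linarith
  have hu1 : u < 2 * π := by rw [hu]; split_ifs <;> linarith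
  have hl : arcLen a (a + u) = u := arcLen_add a hu0.le hu1
  have hne : a + (u : Real.Angle) ≠ a := by
    intro h
    rw [h, arcLen_self] at hl
    linarith
  refine ⟨a + u, fun hm => ?_, hne, fun f hf hfa => ?_⟩
  · obtain ⟨h1, h2⟩ := hF _ hm hne
    rw [hl] at h1 h2
    rw [hu] at h1 h2
    split_ifs at h1 h2 <;> linarith
  · by_contra hne'
    obtain ⟨h1, h2⟩ := hF f hf hne'
    have h3 := arcLen_lt a f
    cases s
    · simp only [sArc, mem_Arc, Bool.false_eq_true, if_false, arcLen_base a (a + u), hl,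
        arcLen_self] at *
      grind
    · simp only [sArc, mem_Arc, if_true, hl] at *
      linarith

theorem Near.mono {s : Bool} {F G : Finset Real.Angle} {a c : Real.Angle} (h : Near s F a c)
    (hG : G ⊆ F) : Near s G a c :=
  ⟨fun hc => h.notMem (hG hc), h.ne, fun f hf => h.arc f (hG hf)⟩

theorem Near.mem_Arc_of_mem {s : Bool} {F : Finset Real.Angle} {a c f g : Real.Angle}
    (h : Near s F a c) (hf : f ∈ F) (hg : g ∈ F) (hc : c ∈ Arc f g) : a ∈ Arc f g := by
  obtain ⟨h0, h1, h2⟩ := h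
  have hf' := h2 f hf
  have hg' := h2 g hg
  have a1 := arcLen_nonneg a c
  have a2 := arcLen_nonneg a f
  have a3 := arcLen_nonneg a g
  have b1 := arcLen_lt a c
  have b2 := arcLen_lt a f
  have b3 := arcLen_lt a g
  have e1 : arcLen a f = arcLen a a ↔ f = a := arcLen_inj
  have e2 : arcLen a g = arcLen a a ↔ g = a := arcLen_inj
  have e3 : arcLen a c = arcLen a a ↔ c = a := arcLen_inj
  have e4 : arcLen a c = arcLen a f ↔ c = f := arcLen_inj
  have e5 : arcLen a c = arcLen a g ↔ c = g := arcLen_inj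
  cases s <;>
  · simp only [sArc, mem_Arc, Bool.false_eq_true, if_false, if_true, arcLen_base a c,
      arcLen_base a f, arcLen_self] at *
    grind

theorem Near.mem_Arc {s : Bool} {F : Finset Real.Angle} {a c f g : Real.Angle}
    (h : Near s F a c) (hf : f ∈ F) (hg : g ∈ F) (haf : a ≠ f) (hag : a ≠ g)
    (ha : a ∈ Arc f g) : c ∈ Arc f g := by
  obtain ⟨h0, h1, h2⟩ := h
  have hf' := h2 f hf
  have hg' := h2 g hg
  have a1 := arcLen_nonneg a c
  have a2 := arcLen_nonneg a f
  have a3 := arcLen_nonneg a g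
  have b1 := arcLen_lt a c
  have b2 := arcLen_lt a f
  have b3 := arcLen_lt a g
  have e1 : arcLen a f = arcLen a a ↔ f = a := arcLen_inj
  have e2 : arcLen a g = arcLen a a ↔ g = a := arcLen_inj
  have e3 : arcLen a c = arcLen a a ↔ c = a := arcLen_inj
  have e4 : arcLen a c = arcLen a f ↔ c = f := arcLen_inj
  have e5 : arcLen a c = arcLen a g ↔ c = g := arcLen_inj
  cases s <;>
  · simp only [sArc, RectDiag.mem_Arc, Bool.false_eq_true, if_false, if_true, arcLen_base a c,
      arcLen_base a f, arcLen_self] at *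
    grind

end Arcs

section Components

/-- Every point of `V` has exactly one partner in `V` with the same value of `f`, and the two
points have opposite signs. -/
def PairOK (f : Torus → Real.Angle) (V : Finset Torus) (sgn : Torus → Bool) : Prop :=
  ∀ u ∈ V, ∃ w ∈ V, w ≠ u ∧ f w = f u ∧ sgn w ≠ sgn u ∧ ∀ x ∈ V, f x = f u → x = u ∨ x = w

theorem pairOK_iff (f : Torus → Real.Angle) (V : Finset Torus) (sgn : Torus → Bool) :
    PairOK f V sgn ↔ ∀ θ : Real.Angle, (∀ v ∈ V, f v ≠ θ) ∨
      ∃ u w, u ∈ V ∧ w ∈ V ∧ u ≠ w ∧ f u = θ ∧ f w = θ ∧ sgn u ≠ sgn w ∧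
        ∀ x ∈ V, f x = θ → x = u ∨ x = w := by
  constructor
  · intro h θ
    by_cases hθ : ∀ v ∈ V, f v ≠ θ
    · exact Or.inl hθ
    · push Not at hθ
      obtain ⟨v, hv, rfl⟩ := hθ
      obtain ⟨w, hw, h1, h2, h3, h4⟩ := h v hv
      exact Or.inr ⟨v, w, hv, hw, h1.symm, rfl, h2, h3.symm, h4⟩
  · intro h u hu
    rcases h (f u) with h | ⟨a, b, ha, hb, hab, h1, h2, h3, h4⟩
    · exact absurd rfl (h u hu)
    · rcases h4 u hu rfl with rfl | rfl
      · exact ⟨b, hb, hab.symm, h2, h3.symm, h4⟩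
      · exact ⟨a, ha, hab, h1, h3, fun x hx hxu => (h4 x hx hxu).symm⟩

theorem isDiagSet_iff (V : Finset Torus) (sgn : Torus → Bool) :
    IsDiagSet V sgn ↔ PairOK Prod.fst V sgn ∧ PairOK Prod.snd V sgn := by
  rw [pairOK_iff, pairOK_iff]; rfl

/-- Two points of `V` lie on a common meridian or longitude. -/
def Adj (V : Finset Torus) (u v : Torus) : Prop :=
  u ∈ V ∧ v ∈ V ∧ (u.1 = v.1 ∨ u.2 = v.2)

theorem Adj.symm {V : Finset Torus} {u v : Torus} (h : Adj V u v) : Adj V v u :=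
  ⟨h.2.1, h.1, h.2.2.imp Eq.symm Eq.symm⟩

/-- Connectivity by paths of edges of `V`. -/
def Conn (V : Finset Torus) : Torus → Torus → Prop :=
  Relation.ReflTransGen (Adj V)

theorem Conn.symm {V : Finset Torus} {u v : Torus} (h : Conn V u v) : Conn V v u := by
  induction h with
  | refl => exact .refl
  | tail _ h ih => exact .head h.symm ih

theorem PairOK.subset {f : Torus → Real.Angle} {V S : Finset Torus} {sgn : Torus → Bool}
    (hV : PairOK f V sgn) (hS : S ⊆ V) (hcl : ∀ x ∈ S, ∀ y ∈ V, f x = f y → y ∈ S) :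
    PairOK f S sgn := by
  intro u hu
  obtain ⟨w, hw, h1, h2, h3, h4⟩ := hV u (hS hu)
  exact ⟨w, hcl u hu w hw h2.symm, h1, h2, h3, fun x hx => h4 x (hS hx)⟩

theorem PairOK.closed {f : Torus → Real.Angle} {V S : Finset Torus} {sgn : Torus → Bool}
    (hV : PairOK f V sgn) (hS : S ⊆ V) (hSp : PairOK f S sgn) :
    ∀ x ∈ S, ∀ y ∈ V, f x = f y → y ∈ S := by
  intro x hx y hy hxy
  obtain ⟨w, hw, h1, h2, h3, h4⟩ := hV x (hS hx)
  obtain ⟨w', hw', h1', h2', -, -⟩ := hSp x hx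
  rcases h4 y hy hxy.symm with rfl | rfl
  · exact hx
  · rcases h4 w' (hS hw') h2' with rfl | rfl
    · exact absurd rfl h1'
    · exact hw'

theorem isDiagSet_subset_iff {V S : Finset Torus} {sgn : Torus → Bool}
    (hV : IsDiagSet V sgn) (hS : S ⊆ V) :
    IsDiagSet S sgn ↔ ∀ x ∈ S, ∀ y, Adj V x y → y ∈ S := by
  rw [isDiagSet_iff] at *
  constructor
  · rintro ⟨h1, h2⟩ x hx y ⟨-, hy, h | h⟩
    · exact hV.1.closed hS h1 x hx y hy h
    · exact hV.2.closed hS h2 x hx y hy h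
  · intro h
    exact ⟨hV.1.subset hS fun x hx y hy hxy => h x hx y ⟨hS hx, hy, Or.inl hxy⟩,
      hV.2.subset hS fun x hx y hy hxy => h x hx y ⟨hS hx, hy, Or.inr hxy⟩⟩

open Classical in
theorem exists_isComponent_iff {V : Finset Torus} {sgn : Torus → Bool} (hV : IsDiagSet V sgn)
    {u v : Torus} (hu : u ∈ V) (hv : v ∈ V) :
    (∃ S, IsComponent V sgn S ∧ u ∈ S ∧ v ∈ S) ↔ Conn V u v := by
  have closed : ∀ S : Finset Torus, (∀ x ∈ S, ∀ y, Adj V x y → y ∈ S) →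
      ∀ x y, x ∈ S → Conn V x y → y ∈ S := by
    intro S hS x y hx hxy
    induction hxy with
    | refl => exact hx
    | tail _ hbc ih => exact hS _ ih _ hbc
  set C := V.filter (Conn V u) with hC
  have hCV : C ⊆ V := Finset.filter_subset _ _
  have hCd : IsDiagSet C sgn := by
    rw [isDiagSet_subset_iff hV hCV]
    intro x hx y hxy
    rw [hC, Finset.mem_filter] at hx ⊢
    exact ⟨hxy.2.1, hx.2.tail hxy⟩
  have huC : u ∈ C := by rw [hC, Finset.mem_filter]; exact ⟨hu, .refl⟩
  constructor
  · rintro ⟨S, ⟨hSV, -, hSd, hmin⟩, huS, hvS⟩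
    have hcl := (isDiagSet_subset_iff hV hSV).1 hSd
    have hsub : C ⊆ S := by
      intro x hx
      rw [hC, Finset.mem_filter] at hx
      exact closed S hcl u x huS hx.2
    rw [← hmin C hsub ⟨u, huC⟩ hCd, hC, Finset.mem_filter] at hvS
    exact hvS.2
  · intro h
    refine ⟨C, ⟨hCV, ⟨u, huC⟩, hCd, fun S hS hne hSd => ?_⟩, huC, ?_⟩
    · refine Finset.Subset.antisymm hS fun z hz => ?_
      have hcl := (isDiagSet_subset_iff hV (hS.trans hCV)).1 hSd
      obtain ⟨x, hx⟩ := hne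
      have hx' := hS hx
      rw [hC, Finset.mem_filter] at hx' hz
      exact closed S hcl x z hx (hx'.2.symm.trans hz.2)
    · rw [hC, Finset.mem_filter]; exact ⟨hv, h⟩

namespace RectDiagram

theorem fst_ok (R : RectDiagram) : PairOK Prod.fst R.verts R.sgn :=
  ((isDiagSet_iff _ _).1 R.diag).1

theorem snd_ok (R : RectDiagram) : PairOK Prod.snd R.verts R.sgn :=
  ((isDiagSet_iff _ _).1 R.diag).2

theorem comp_eq_iff_conn (R : RectDiagram) {u v : Torus} (hu : u ∈ R.verts) (hv : v ∈ R.verts) :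
    R.comp u = R.comp v ↔ Conn R.verts u v := by
  rw [R.comp_eq_iff u hu v hv, exists_isComponent_iff R.diag hu hv]

theorem comp_eq_of_adj (R : RectDiagram) {u v : Torus} (h : Adj R.verts u v) :
    R.comp u = R.comp v :=
  (R.comp_eq_iff_conn h.1 h.2.1).2 (.single h)

/-- A diagram from pairing and connectivity data. -/
def ofConn (V : Finset Torus) (sgn : Torus → Bool) (comp : Torus → ℕ)
    (h1 : PairOK Prod.fst V sgn) (h2 : PairOK Prod.snd V sgn)
    (h3 : ∀ u ∈ V, ∀ v ∈ V, (comp u = comp v ↔ Conn V u v)) : RectDiagram where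
  verts := V
  sgn := sgn
  comp := comp
  diag := (isDiagSet_iff _ _).2 ⟨h1, h2⟩
  comp_eq_iff u hu v hv := by
    rw [exists_isComponent_iff ((isDiagSet_iff _ _).2 ⟨h1, h2⟩) hu hv, h3 u hu v hv]

theorem four_le_card_comp (R : RectDiagram) {u : Torus} (hu : u ∈ R.verts) :
    4 ≤ (R.verts.filter fun v => R.comp v = R.comp u).card := by
  obtain ⟨a, b⟩ := u
  obtain ⟨⟨a1, b1⟩, hw, h1, h2, -, -⟩ := R.fst_ok _ hu
  obtain ⟨⟨a2, b2⟩, hx, h3, h4, -, -⟩ := R.snd_ok _ hu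
  obtain ⟨⟨a3, b3⟩, hy, h5, h6, -, -⟩ := R.snd_ok _ hw
  simp only [ne_eq, Prod.mk.injEq] at *
  subst h2 h4 h6
  have e1 := R.comp_eq_of_adj ⟨hw, hu, Or.inl rfl⟩
  have e2 := R.comp_eq_of_adj ⟨hx, hu, Or.inr rfl⟩
  have e3 := R.comp_eq_of_adj ⟨hy, hw, Or.inr rfl⟩
  have : ({(a1, b2), (a1, b3), (a2, b2), (a3, b3)} : Finset Torus) ⊆
      R.verts.filter fun v => R.comp v = R.comp (a1, b2) := by
    intro z hz
    simp only [Finset.mem_insert, Finset.mem_singleton] at hz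
    rw [Finset.mem_filter]
    rcases hz with rfl | rfl | rfl | rfl
    · exact ⟨hu, rfl⟩
    · exact ⟨hw, e1⟩
    · exact ⟨hx, e2⟩
    · exact ⟨hy, e3.trans e1⟩
  refine le_trans (le_of_eq ?_) (Finset.card_le_card this)
  rw [Finset.card_insert_of_notMem, Finset.card_insert_of_notMem, Finset.card_insert_of_notMem,
    Finset.card_singleton] <;> grind

end RectDiagram

end Components

section Stabilization

/-- The vertex set obtained from `V` by replacing `v` with the three other corners of the
rectangle spanned by `v` and `(c, d)`. -/
def stabVerts (V : Finset Torus) (v : Torus) (c d : Real.Angle) : Finset Torus :=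
  insert (v.1, d) (insert (c, d) (insert (c, v.2) (V.erase v)))

theorem mem_stabVerts {V : Finset Torus} {v : Torus} {c d : Real.Angle} {u : Torus} :
    u ∈ stabVerts V v c d ↔ u = (v.1, d) ∨ u = (c, d) ∨ u = (c, v.2) ∨ (u ∈ V ∧ u ≠ v) := by
  simp only [stabVerts, Finset.mem_insert, Finset.mem_erase]
  tauto

/-- The map sending the three new corners to `v` and fixing all other points. -/
def collapse (v : Torus) (c d : Real.Angle) (u : Torus) : Torus :=
  if u = (v.1, d) ∨ u = (c, d) ∨ u = (c, v.2) then v else u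

/-- The signs after a stabilization. -/
def stabSgn (sgn : Torus → Bool) (v : Torus) (c d : Real.Angle) (u : Torus) : Bool :=
  if u = (c, d) then !sgn v else sgn (collapse v c d u)

variable {V : Finset Torus} {sgn : Torus → Bool} {v : Torus} {c d : Real.Angle}

theorem card_stabVerts (hv : v ∈ V) (hc : ∀ u ∈ V, u.1 ≠ c) (hd : ∀ u ∈ V, u.2 ≠ d) :
    (stabVerts V v c d).card = V.card + 2 := by
  have h1 := hc v hv
  have h2 := hd v hv
  have h3 : 0 < V.card := Finset.card_pos.2 ⟨v, hv⟩
  unfold stabVerts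
  rw [Finset.card_insert_of_notMem, Finset.card_insert_of_notMem, Finset.card_insert_of_notMem,
    Finset.card_erase_of_mem hv]
  · omega
  all_goals
    simp only [Finset.mem_insert, Finset.mem_erase, Prod.mk.injEq, not_or]
    grind

theorem PairOK.stab_fst (hv : v ∈ V) (hc : ∀ u ∈ V, u.1 ≠ c) (hd : ∀ u ∈ V, u.2 ≠ d)
    (h : PairOK Prod.fst V sgn) :
    PairOK Prod.fst (stabVerts V v c d) (stabSgn sgn v c d) := by
  obtain ⟨a, b⟩ := v
  have hc' := hc _ hv
  have hd' := hd _ hv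
  obtain ⟨⟨a', b'⟩, hw, h1, h2, h3, h4⟩ := h _ hv
  intro u hu
  simp only [mem_stabVerts, stabSgn, collapse] at *
  rcases hu with rfl | rfl | rfl | ⟨hu, huv⟩
  · refine ⟨(a', b'), ?_⟩
    grind
  · refine ⟨(c, b), ?_⟩
    grind
  · refine ⟨(c, d), ?_⟩
    grind
  · obtain ⟨w, hw', g1, g2, g3, g4⟩ := h u hu
    by_cases hwv : w = (a, b)
    · refine ⟨(a, d), ?_⟩
      grind
    · refine ⟨w, ?_⟩
      grind

theorem PairOK.stab_snd (hv : v ∈ V) (hc : ∀ u ∈ V, u.1 ≠ c) (hd : ∀ u ∈ V, u.2 ≠ d)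
    (h : PairOK Prod.snd V sgn) :
    PairOK Prod.snd (stabVerts V v c d) (stabSgn sgn v c d) := by
  obtain ⟨a, b⟩ := v
  have hc' := hc _ hv
  have hd' := hd _ hv
  obtain ⟨⟨a', b'⟩, hw, h1, h2, h3, h4⟩ := h _ hv
  intro u hu
  simp only [mem_stabVerts, stabSgn, collapse] at *
  rcases hu with rfl | rfl | rfl | ⟨hu, huv⟩
  · refine ⟨(c, d), ?_⟩
    grind
  · refine ⟨(a, d), ?_⟩
    grind
  · refine ⟨(a', b'), ?_⟩
    grind
  · obtain ⟨w, hw', g1, g2, g3, g4⟩ := h u hu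
    by_cases hwv : w = (a, b)
    · refine ⟨(c, b), ?_⟩
      grind
    · refine ⟨w, ?_⟩
      grind

theorem collapse_mem (hv : v ∈ V) {u : Torus} (hu : u ∈ stabVerts V v c d) :
    collapse v c d u ∈ V := by
  rw [mem_stabVerts] at hu
  unfold collapse
  split_ifs <;> grind

theorem Adj.collapse (hv : v ∈ V) (hc : ∀ u ∈ V, u.1 ≠ c) (hd : ∀ u ∈ V, u.2 ≠ d)
    {u w : Torus} (h : Adj (stabVerts V v c d) u w) :
    collapse v c d u = collapse v c d w ∨
      Adj V (collapse v c d u) (collapse v c d w) := by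
  by_cases e : RectDiag.collapse v c d u = RectDiag.collapse v c d w
  · exact Or.inl e
  refine Or.inr ⟨collapse_mem hv h.1, collapse_mem hv h.2.1, ?_⟩
  obtain ⟨hu, hw, h⟩ := h
  rw [mem_stabVerts] at hu hw
  unfold RectDiag.collapse at *
  grind

theorem conn_stabVerts_iff (hv : v ∈ V) (hc : ∀ u ∈ V, u.1 ≠ c) (hd : ∀ u ∈ V, u.2 ≠ d)
    {u w : Torus} (hu : u ∈ stabVerts V v c d) (hw : w ∈ stabVerts V v c d) :
    Conn (stabVerts V v c d) u w ↔ Conn V (collapse v c d u) (collapse v c d w) := by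
  constructor
  · intro h
    clear hw
    induction h with
    | refl => exact .refl
    | tail _ h ih =>
      rcases h.collapse hv hc hd with e | e
      · rwa [← e]
      · exact ih.tail e
  · intro h
    have m1 : (v.1, d) ∈ stabVerts V v c d := by simp [mem_stabVerts]
    have m2 : (c, d) ∈ stabVerts V v c d := by simp [mem_stabVerts]
    have m3 : (c, v.2) ∈ stabVerts V v c d := by simp [mem_stabVerts]
    have a1 : Conn (stabVerts V v c d) (v.1, d) (c, d) := .single ⟨m1, m2, Or.inr rfl⟩
    have a2 : Conn (stabVerts V v c d) (c, v.2) (c, d) := .single ⟨m3, m2, Or.inl rfl⟩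
    let σ : Torus → Torus := fun x => if x = v then (c, d) else x
    have key : ∀ x y, Conn V x y → Conn (stabVerts V v c d) (σ x) (σ y) := by
      intro x y hxy
      induction hxy with
      | refl => exact .refl
      | @tail y z _ h ih =>
        refine ih.trans ?_
        obtain ⟨hy, hz, h⟩ := h
        by_cases e1 : y = v <;> by_cases e2 : z = v
        · rw [e1, e2]
        · have hz' : z ∈ stabVerts V v c d := by rw [mem_stabVerts]; tauto
          simp only [σ, e1, e2, if_true, if_false]
          rw [e1] at h
          rcases h with h | h
          · exact a1.symm.tail ⟨m1, hz', Or.inl h⟩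
          · exact a2.symm.tail ⟨m3, hz', Or.inr h⟩
        · have hy' : y ∈ stabVerts V v c d := by rw [mem_stabVerts]; tauto
          simp only [σ, e1, e2, if_true, if_false]
          rw [e2] at h
          rcases h with h | h
          · exact .head ⟨hy', m1, Or.inl h⟩ a1
          · exact .head ⟨hy', m3, Or.inr h⟩ a2
        · simp only [σ, e1, e2, if_false]
          refine .single ⟨?_, ?_, h⟩ <;> rw [mem_stabVerts] <;> tauto
    have lift : ∀ x ∈ stabVerts V v c d,
        Conn (stabVerts V v c d) x (σ (collapse v c d x)) := by
      intro x hx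
      have h1 := hc v hv
      rw [mem_stabVerts] at hx
      rcases hx with rfl | rfl | rfl | ⟨hx, hxv⟩
      · simpa [σ, collapse] using a1
      · simp only [σ, collapse, true_or, or_true, if_true]
        exact .refl
      · simpa [σ, collapse] using a2
      · have : collapse v c d x = x := by
          unfold collapse; rw [if_neg]; grind
        rw [this]
        simp only [σ, hxv, if_false]
        exact .refl
    exact (lift u hu).trans ((key _ _ h).trans (lift w hw).symm)

namespace RectDiagram

/-- The result of replacing the vertex `v` of `R` by the three other corners of the rectangle
spanned by `v` and `(c, d)`, where the meridian `c` and the longitude `d` are unoccupied. -/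
def stab (R : RectDiagram) (v : Torus) (c d : Real.Angle) (hv : v ∈ R.verts)
    (hc : ∀ u ∈ R.verts, u.1 ≠ c) (hd : ∀ u ∈ R.verts, u.2 ≠ d) : RectDiagram :=
  ofConn (stabVerts R.verts v c d) (stabSgn R.sgn v c d) (fun u => R.comp (collapse v c d u))
    (R.fst_ok.stab_fst hv hc hd) (R.snd_ok.stab_snd hv hc hd) fun u hu w hw => by
      rw [conn_stabVerts_iff hv hc hd hu hw,
        R.comp_eq_iff_conn (collapse_mem hv hu) (collapse_mem hv hw)]

end RectDiagram

end Stabilization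

section Relabelling

theorem PairOK.map {V : Finset Torus} {sgn : Torus → Bool} {f g : Torus → Real.Angle}
    (e : Torus ≃ Torus) (he : ∀ u w, g (e u) = g (e w) ↔ f u = f w) (h : PairOK f V sgn) :
    PairOK g (V.map e.toEmbedding) (sgn ∘ e.symm) := by
  intro u hu
  obtain ⟨u, hu', rfl⟩ := Finset.mem_map.1 hu
  obtain ⟨w, hw, h1, h2, h3, h4⟩ := h u hu'
  refine ⟨e w, Finset.mem_map_of_mem _ hw, by simpa using h1, ?_, by simpa using h3, ?_⟩
  · exact (he _ _).2 h2
  · intro x hx hxu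
    obtain ⟨x, hx', rfl⟩ := Finset.mem_map.1 hx
    have := h4 x hx' ((he _ _).1 hxu)
    simpa using this

theorem conn_map_iff {V : Finset Torus} (e : Torus ≃ Torus)
    (he : ∀ u w, ((e u).1 = (e w).1 ∨ (e u).2 = (e w).2) ↔ (u.1 = w.1 ∨ u.2 = w.2))
    {u w : Torus} : Conn (V.map e.toEmbedding) (e u) (e w) ↔ Conn V u w := by
  have hadj : ∀ u w, Adj (V.map e.toEmbedding) (e u) (e w) ↔ Adj V u w := by
    intro u w
    simp [Adj, he]
  constructor
  · intro h
    have : Conn V (e.symm (e u)) (e.symm (e w)) := Relation.ReflTransGen.lift (p := Adj V) e.symm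
      (fun a b hab => (hadj _ _).1 (by simpa using hab)) _ _ h
    simpa using this
  · intro h
    exact Relation.ReflTransGen.lift e (fun a b hab => (hadj _ _).2 hab) _ _ h

namespace RectDiagram

/-- The mirror image of a diagram exchanging the two coordinates. -/
def transpose (R : RectDiagram) : RectDiagram :=
  ofConn (R.verts.map (Equiv.prodComm _ _).toEmbedding) (R.sgn ∘ (Equiv.prodComm _ _).symm)
    (R.comp ∘ (Equiv.prodComm _ _).symm)
    (R.snd_ok.map _ fun _ _ => Iff.rfl) (R.fst_ok.map _ fun _ _ => Iff.rfl) fun u hu w hw => by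
      obtain ⟨u, hu', rfl⟩ := Finset.mem_map.1 hu
      obtain ⟨w, hw', rfl⟩ := Finset.mem_map.1 hw
      refine Iff.trans ?_ (conn_map_iff _ fun _ _ => ?_).symm
      · simpa using R.comp_eq_iff_conn hu' hw'
      · exact or_comm

/-- Relabelling the second coordinate by exchanging `b` and `y`. -/
def swapEquiv (b y : Real.Angle) : Torus ≃ Torus :=
  Equiv.prodCongr (Equiv.refl _) (Equiv.swap b y)

/-- The diagram obtained by exchanging the longitudes `b` and `y`. -/
def swapSnd (R : RectDiagram) (b y : Real.Angle) : RectDiagram :=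
  ofConn (R.verts.map (swapEquiv b y).toEmbedding) (R.sgn ∘ (swapEquiv b y).symm)
    (R.comp ∘ (swapEquiv b y).symm)
    (R.fst_ok.map _ fun _ _ => Iff.rfl)
    (R.snd_ok.map _ fun _ _ => (Equiv.swap b y).injective.eq_iff) fun u hu w hw => by
      obtain ⟨u, hu', rfl⟩ := Finset.mem_map.1 hu
      obtain ⟨w, hw', rfl⟩ := Finset.mem_map.1 hw
      refine Iff.trans ?_ (conn_map_iff _ fun _ _ => ?_).symm
      · simpa using R.comp_eq_iff_conn hu' hw'
      · exact or_congr Iff.rfl (Equiv.swap b y).injective.eq_iff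

@[simp] theorem stab_verts (R : RectDiagram) {v : Torus} {c d : Real.Angle} (hv : v ∈ R.verts)
    (hc : ∀ u ∈ R.verts, u.1 ≠ c) (hd : ∀ u ∈ R.verts, u.2 ≠ d) :
    (R.stab v c d hv hc hd).verts = stabVerts R.verts v c d := rfl

@[simp] theorem stab_sgn (R : RectDiagram) {v : Torus} {c d : Real.Angle} (hv : v ∈ R.verts)
    (hc : ∀ u ∈ R.verts, u.1 ≠ c) (hd : ∀ u ∈ R.verts, u.2 ≠ d) :
    (R.stab v c d hv hc hd).sgn = stabSgn R.sgn v c d := rfl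

@[simp] theorem stab_comp (R : RectDiagram) {v : Torus} {c d : Real.Angle} (hv : v ∈ R.verts)
    (hc : ∀ u ∈ R.verts, u.1 ≠ c) (hd : ∀ u ∈ R.verts, u.2 ≠ d) (u : Torus) :
    (R.stab v c d hv hc hd).comp u = R.comp (collapse v c d u) := rfl

@[simp] theorem mem_transpose (R : RectDiagram) (u : Torus) :
    u ∈ R.transpose.verts ↔ u.swap ∈ R.verts := by
  simp [transpose, ofConn, Finset.mem_map_equiv]

@[simp] theorem transpose_sgn (R : RectDiagram) (u : Torus) :
    R.transpose.sgn u = R.sgn u.swap := rfl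

@[simp] theorem transpose_comp (R : RectDiagram) (u : Torus) :
    R.transpose.comp u = R.comp u.swap := rfl

@[simp] theorem mem_swapSnd (R : RectDiagram) (b y : Real.Angle) (u : Torus) :
    u ∈ (R.swapSnd b y).verts ↔ (u.1, Equiv.swap b y u.2) ∈ R.verts := by
  simp only [swapSnd, ofConn, Finset.mem_map_equiv]
  rfl

@[simp] theorem swapSnd_sgn (R : RectDiagram) (b y : Real.Angle) (u : Torus) :
    (R.swapSnd b y).sgn u = R.sgn (u.1, Equiv.swap b y u.2) := rfl

@[simp] theorem swapSnd_comp (R : RectDiagram) (b y : Real.Angle) (u : Torus) :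
    (R.swapSnd b y).comp u = R.comp (u.1, Equiv.swap b y u.2) := rfl

end RectDiagram

end Relabelling

section Moves

theorem mem_corners {t1 t2 p1 p2 : Real.Angle} {u : Torus} :
    u ∈ corners t1 t2 p1 p2 ↔ (u.1 = t1 ∨ u.1 = t2) ∧ (u.2 = p1 ∨ u.2 = p2) := by
  obtain ⟨a, b⟩ := u
  simp only [corners, Finset.mem_insert, Finset.mem_singleton, Prod.mk.injEq]
  tauto

theorem isElemMoveWith_iff {R₁ R₂ : RectDiagram} {t1 t2 p1 p2 : Real.Angle} :
    IsElemMoveWith R₁ R₂ t1 t2 p1 p2 ↔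
      t1 ≠ t2 ∧ p1 ≠ p2 ∧
      (∀ u, u ∈ corners t1 t2 p1 p2 ↔ (u ∈ R₁.verts ∧ u ∉ R₂.verts ∨ u ∈ R₂.verts ∧ u ∉ R₁.verts)) ∧
      (∃ u v : Torus, u ∈ corners t1 t2 p1 p2 ∧ v ∈ corners t1 t2 p1 p2 ∧
        (IsEdge R₁ u v ∨ IsEdge R₂ u v)) ∧
      ¬ R₁.verts ⊆ R₂.verts ∧ ¬ R₂.verts ⊆ R₁.verts ∧
      (∀ u, u ∈ R₁.verts ∨ u ∈ R₂.verts → u.1 ∈ Arc t1 t2 → u.2 ∈ Arc p1 p2 →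
        u ∈ corners t1 t2 p1 p2) ∧
      ∀ v, v ∈ R₁.verts → v ∈ R₂.verts → R₁.sgn v = R₂.sgn v ∧ R₁.comp v = R₂.comp v := by
  unfold IsElemMoveWith
  constructor
  · rintro ⟨h1, h2, h3, h4, h5, h6, h7, h8⟩
    rw [h3] at h4
    refine ⟨h1, h2, fun u => ?_, h4, h5, h6, fun u hu hu1 hu2 => ?_, fun v hv hv' => ?_⟩
    · rw [← h3, Finset.mem_symmDiff]
    · have : u ∈ RectSet t1 t2 p1 p2 ∩ (↑R₁.verts ∪ ↑R₂.verts) := ⟨⟨hu1, hu2⟩, hu⟩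
      rw [h7] at this
      exact this
    · exact h8 v (Finset.mem_inter.2 ⟨hv, hv'⟩)
  · rintro ⟨h1, h2, h3, h4, h5, h6, h7, h8⟩
    have e : symmDiff R₁.verts R₂.verts = corners t1 t2 p1 p2 := by
      ext u
      rw [Finset.mem_symmDiff, h3]
    rw [e]
    refine ⟨h1, h2, rfl, h4, h5, h6, ?_, fun v hv => ?_⟩
    · ext u
      constructor
      · rintro ⟨⟨hu1, hu2⟩, hu⟩
        exact h7 u hu hu1 hu2
      · intro hu
        have hu' : u ∈ corners t1 t2 p1 p2 := hu
        refine ⟨?_, ?_⟩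
        · rw [mem_corners] at hu'
          constructor
          · rcases hu'.1 with h | h <;> rw [h]
            · exact left_mem_sArc true _ _
            · exact right_mem_sArc true _ _
          · rcases hu'.2 with h | h <;> rw [h]
            · exact left_mem_sArc true _ _
            · exact right_mem_sArc true _ _
        · rw [h3] at hu'
          rcases hu' with h | h
          · exact Or.inl h.1
          · exact Or.inr h.1
    · rw [Finset.mem_inter] at hv
      exact h8 v hv.1 hv.2

theorem IsElemMoveWith.symm {R₁ R₂ : RectDiagram} {t1 t2 p1 p2 : Real.Angle}
    (h : IsElemMoveWith R₁ R₂ t1 t2 p1 p2) : IsElemMoveWith R₂ R₁ t1 t2 p1 p2 := by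
  rw [isElemMoveWith_iff] at *
  obtain ⟨h1, h2, h3, ⟨u, v, hu, hv, h4⟩, h5, h6, h7, h8⟩ := h
  refine ⟨h1, h2, fun u => (h3 u).trans Or.comm, ⟨u, v, hu, hv, h4.symm⟩, h6, h5,
    fun u hu => h7 u hu.symm, fun v hv hv' => ?_⟩
  obtain ⟨e1, e2⟩ := h8 v hv' hv
  exact ⟨e1.symm, e2.symm⟩

theorem MoveNoI.symm {R₁ R₂ : RectDiagram} (h : MoveNoI R₁ R₂) : MoveNoI R₂ R₁ := by
  obtain ⟨⟨t1, t2, p1, p2, h⟩, h1, h2⟩ := h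
  exact ⟨⟨t1, t2, p1, p2, h.symm⟩, h2, h1⟩

/-- Being related by a chain of elementary moves without type I (de)stabilizations. -/
abbrev Related : RectDiagram → RectDiagram → Prop := Relation.ReflTransGen MoveNoI

theorem Related.symm {R₁ R₂ : RectDiagram} (h : Related R₁ R₂) : Related R₂ R₁ := by
  induction h with
  | refl => exact .refl
  | tail _ h ih => exact .head h.symm ih

/-- The two diagrams have the same vertices with the same signs and component numbers. -/
def Agree (R R' : RectDiagram) : Prop :=
  R.verts = R'.verts ∧ ∀ v ∈ R.verts, R.sgn v = R'.sgn v ∧ R.comp v = R'.comp v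

theorem Agree.symm {R R' : RectDiagram} (h : Agree R R') : Agree R' R :=
  ⟨h.1.symm, fun v hv => ⟨(h.2 v (h.1 ▸ hv)).1.symm, (h.2 v (h.1 ▸ hv)).2.symm⟩⟩

theorem IsElemMoveWith.congr {R R' S : RectDiagram} {t1 t2 p1 p2 : Real.Angle} (h : Agree R R')
    (hm : IsElemMoveWith R' S t1 t2 p1 p2) : IsElemMoveWith R S t1 t2 p1 p2 := by
  rw [isElemMoveWith_iff] at *
  obtain ⟨e, h⟩ := h
  simp only [IsEdge, e] at *
  obtain ⟨h1, h2, h3, h4, h5, h6, h7, h8⟩ := hm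
  refine ⟨h1, h2, h3, h4, h5, h6, h7, fun v hv hv' => ?_⟩
  rw [(h v hv).1, (h v hv).2]
  exact h8 v hv hv'

theorem MoveNoI.congr {R R' S : RectDiagram} (h : Agree R R') (hm : MoveNoI R' S) :
    MoveNoI R S := by
  obtain ⟨⟨t1, t2, p1, p2, hm⟩, hn1, hn2⟩ := hm
  refine ⟨⟨t1, t2, p1, p2, hm.congr h⟩, ?_, ?_⟩
  · rintro ⟨t1, t2, p1, p2, ⟨hs, hc⟩, hI⟩
    refine hn1 ⟨t1, t2, p1, p2, ⟨hs.congr h.symm, ?_⟩, ?_⟩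
    · rw [← h.1, hc]
    · unfold TypeICornerCond at *
      rwa [← h.1]
  · rintro ⟨t1, t2, p1, p2, ⟨hs, hc⟩, hI⟩
    exact hn2 ⟨t1, t2, p1, p2, ⟨(hs.symm.congr h.symm).symm, by rw [← h.1, hc]⟩, hI⟩

theorem moveNoI_of_card_eq {X Y : RectDiagram} (h : IsElemMove X Y)
    (hc : X.verts.card = Y.verts.card) : MoveNoI X Y := by
  refine ⟨h, ?_, ?_⟩
  · rintro ⟨t1, t2, p1, p2, ⟨-, h⟩, -⟩
    omega
  · rintro ⟨t1, t2, p1, p2, ⟨-, h⟩, -⟩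
    omega

theorem corners_comm_fst (t1 t2 p1 p2 : Real.Angle) :
    corners t1 t2 p1 p2 = corners t2 t1 p1 p2 := by
  ext u; simp only [mem_corners]; tauto

theorem corners_comm_snd (t1 t2 p1 p2 : Real.Angle) :
    corners t1 t2 p1 p2 = corners t1 t2 p2 p1 := by
  ext u; simp only [mem_corners]; tauto

/-- Criterion for two diagrams to be related by an exchange move. -/
theorem moveNoI_of_exchange {X Y : RectDiagram} (s s' : Bool) {c c' b d : Real.Angle}
    (hcc : c ≠ c') (hbd : b ≠ d)
    (hcorn : ∀ u ∈ corners c c' b d, (u ∈ X.verts ↔ u ∉ Y.verts))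
    (hnon : ∀ u ∉ corners c c' b d, (u ∈ X.verts ↔ u ∈ Y.verts))
    (hcard : X.verts.card = Y.verts.card)
    (hedge : ∃ u v, u ∈ corners c c' b d ∧ v ∈ corners c c' b d ∧ IsEdge X u v)
    (hemp : ∀ u ∈ X.verts, u.1 ∈ sArc s c c' → u.2 ∈ sArc s' b d → u ∈ corners c c' b d)
    (hag : ∀ u, u ∈ X.verts → u ∈ Y.verts → X.sgn u = Y.sgn u ∧ X.comp u = Y.comp u) :
    MoveNoI X Y := by
  refine moveNoI_of_card_eq ?_ hcard
  have hdiff : ∀ u, u ∈ corners c c' b d ↔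
      (u ∈ X.verts ∧ u ∉ Y.verts ∨ u ∈ Y.verts ∧ u ∉ X.verts) := by
    intro u
    have h1 := hcorn u
    have h2 := hnon u
    tauto
  have hXY : ¬ X.verts ⊆ Y.verts := by
    obtain ⟨u, v, hu, hv, he⟩ := hedge
    intro hsub
    exact (hcorn u hu).1 he.1 (hsub he.1)
  have hYX : ¬ Y.verts ⊆ X.verts := by
    intro hsub
    exact hXY (Finset.eq_of_subset_of_card_le hsub hcard.le).superset
  have hedge' : ∃ u v, u ∈ corners c c' b d ∧ v ∈ corners c c' b d ∧
      (IsEdge X u v ∨ IsEdge Y u v) := by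
    obtain ⟨u, v, hu, hv, he⟩ := hedge
    exact ⟨u, v, hu, hv, Or.inl he⟩
  have hemp' : ∀ u, u ∈ X.verts ∨ u ∈ Y.verts → u.1 ∈ sArc s c c' → u.2 ∈ sArc s' b d →
      u ∈ corners c c' b d := by
    intro u hu h1 h2
    by_contra hu'
    have := hnon u hu'
    exact hu' (hemp u (by tauto) h1 h2)
  cases s <;> cases s'
  · refine ⟨c', c, d, b, isElemMoveWith_iff.2 ?_⟩
    rw [corners_comm_fst, corners_comm_snd]
    exact ⟨hcc.symm, hbd.symm, hdiff, hedge', hXY, hYX, hemp', hag⟩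
  · refine ⟨c', c, b, d, isElemMoveWith_iff.2 ?_⟩
    rw [corners_comm_fst]
    exact ⟨hcc.symm, hbd, hdiff, hedge', hXY, hYX, hemp', hag⟩
  · refine ⟨c, c', d, b, isElemMoveWith_iff.2 ?_⟩
    rw [corners_comm_snd]
    exact ⟨hcc, hbd.symm, hdiff, hedge', hXY, hYX, hemp', hag⟩
  · exact ⟨c, c', b, d, isElemMoveWith_iff.2
      ⟨hcc, hbd, hdiff, hedge', hXY, hYX, hemp', hag⟩⟩

namespace RectDiagram

theorem eq_of {R R' : RectDiagram} (h1 : R.verts = R'.verts) (h2 : R.sgn = R'.sgn)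
    (h3 : R.comp = R'.comp) : R = R' := by
  cases R; cases R'
  subst h1 h2 h3
  rfl

@[simp] theorem transpose_transpose (R : RectDiagram) : R.transpose.transpose = R := by
  apply eq_of
  · ext u; simp
  · rfl
  · rfl

@[simp] theorem card_transpose (R : RectDiagram) : R.transpose.verts.card = R.verts.card :=
  Finset.card_map _

end RectDiagram

theorem swap_mem_corners {t1 t2 p1 p2 : Real.Angle} {u : Torus} :
    u.swap ∈ corners t1 t2 p1 p2 ↔ u ∈ corners p1 p2 t1 t2 := by
  simp only [mem_corners, Prod.fst_swap, Prod.snd_swap]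
  tauto

theorem isEdge_transpose {R : RectDiagram} {u v : Torus} :
    IsEdge R.transpose u v ↔ IsEdge R u.swap v.swap := by
  simp only [IsEdge, RectDiagram.mem_transpose, Prod.fst_swap, Prod.snd_swap, ne_eq,
    Prod.swap_inj]
  tauto

theorem transpose_subset_iff {R R' : RectDiagram} :
    R.transpose.verts ⊆ R'.transpose.verts ↔ R.verts ⊆ R'.verts := by
  constructor
  · intro h u hu
    have := @h u.swap (by simpa using hu)
    simpa using this
  · intro h u hu
    rw [RectDiagram.mem_transpose] at *
    exact h hu

theorem IsElemMoveWith.transpose {R₁ R₂ : RectDiagram} {t1 t2 p1 p2 : Real.Angle}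
    (h : IsElemMoveWith R₁ R₂ t1 t2 p1 p2) :
    IsElemMoveWith R₁.transpose R₂.transpose p1 p2 t1 t2 := by
  rw [isElemMoveWith_iff] at *
  obtain ⟨h1, h2, h3, ⟨u, v, hu, hv, h4⟩, h5, h6, h7, h8⟩ := h
  simp only [RectDiagram.mem_transpose, transpose_subset_iff, isEdge_transpose,
    ← swap_mem_corners (t1 := t1) (p1 := p1)]
  refine ⟨h2, h1, fun u => h3 _, ⟨u.swap, v.swap, by simpa using hu, by simpa using hv,
    by simpa using h4⟩, h5, h6, fun u hu a1 a2 => h7 _ hu a2 a1, fun v hv hv' => h8 _ hv hv'⟩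

theorem IsTypeIStab.transpose {R₁ R₂ : RectDiagram} (h : IsTypeIStab R₁ R₂) :
    IsTypeIStab R₁.transpose R₂.transpose := by
  obtain ⟨t1, t2, p1, p2, ⟨h1, h2⟩, h3⟩ := h
  refine ⟨p1, p2, t1, t2, ⟨h1.transpose, by simpa using h2⟩, fun v hv hvc => ?_⟩
  rw [RectDiagram.mem_transpose] at hv
  have := h3 v.swap hv (swap_mem_corners.2 hvc)
  simpa [Prod.ext_iff, and_comm] using this

theorem MoveNoI.transpose {R₁ R₂ : RectDiagram} (h : MoveNoI R₁ R₂) :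
    MoveNoI R₁.transpose R₂.transpose := by
  obtain ⟨⟨t1, t2, p1, p2, h⟩, h1, h2⟩ := h
  refine ⟨⟨p1, p2, t1, t2, h.transpose⟩, fun h => h1 ?_, fun h => h2 ?_⟩
  · simpa using IsTypeIStab.transpose h
  · simpa [IsTypeIDestab] using IsTypeIStab.transpose h

theorem Related.transpose {R₁ R₂ : RectDiagram} (h : Related R₁ R₂) :
    Related R₁.transpose R₂.transpose :=
  Relation.ReflTransGen.lift RectDiagram.transpose (fun _ _ => MoveNoI.transpose) _ _ h

theorem related_transpose_iff {R₁ R₂ : RectDiagram} :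
    Related R₁.transpose R₂.transpose ↔ Related R₁ R₂ :=
  ⟨fun h => by simpa using h.transpose, Related.transpose⟩

end Moves

section WellDefined

/-- The data of a type I stabilization of `R` at the vertex `v`: the rectangle spanned by `v` and
`(c, d)`, lying to the upper right of `v` if `s = true` and to the lower left otherwise, contains
no vertex of `R` other than `v`, and `c`, `d` are unoccupied. -/
structure StabData (R : RectDiagram) (s : Bool) (v : Torus) (c d : Real.Angle) : Prop where
  mem : v ∈ R.verts
  fst : ∀ u ∈ R.verts, u.1 ≠ c
  snd : ∀ u ∈ R.verts, u.2 ≠ d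
  empty : ∀ u ∈ R.verts, u.1 ∈ sArc s v.1 c → u.2 ∈ sArc s v.2 d → u = v

variable {R : RectDiagram} {s : Bool} {v w : Torus} {c d c' d' : Real.Angle}

/-- The stabilized diagram. -/
abbrev StabData.diagram (h : StabData R s v c d) : RectDiagram :=
  R.stab v c d h.mem h.fst h.snd

theorem StabData.transpose (h : StabData R s v c d) : StabData R.transpose s v.swap d c where
  mem := by simpa using h.mem
  fst u hu := h.snd u.swap (by simpa using hu)
  snd u hu := h.fst u.swap (by simpa using hu)
  empty u hu h1 h2 := by
    have := h.empty u.swap (by simpa using hu) h2 h1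
    rw [← this, Prod.swap_swap]

theorem StabData.diagram_transpose (h : StabData R s v c d) :
    h.transpose.diagram = h.diagram.transpose := by
  have hc : ∀ u, collapse v.swap d c u = (collapse v c d u.swap).swap := by
    rintro ⟨x, y⟩
    simp only [collapse, Prod.ext_iff, Prod.fst_swap, Prod.snd_swap]
    grind
  apply RectDiagram.eq_of
  · ext ⟨x, y⟩
    simp only [RectDiagram.stab_verts, mem_stabVerts, RectDiagram.mem_transpose, Prod.ext_iff,
      Prod.fst_swap, Prod.snd_swap, ne_eq]
    tauto
  · funext u
    simp only [RectDiagram.stab_sgn, RectDiagram.transpose_sgn, stabSgn, hc, Prod.swap_swap]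
    obtain ⟨x, y⟩ := u
    simp only [Prod.ext_iff, Prod.fst_swap, Prod.snd_swap]
    grind
  · funext u
    simp only [RectDiagram.stab_comp, RectDiagram.transpose_comp, hc, Prod.swap_swap]

theorem StabData.shrink_fst (h : StabData R s v c d) (hc : c' ∈ sArc s v.1 c)
    (hf : ∀ u ∈ R.verts, u.1 ≠ c') : StabData R s v c' d where
  mem := h.mem
  fst := hf
  snd := h.snd
  empty u hu h1 h2 := h.empty u hu (sArc_subset_left hc h1) h2

theorem StabData.moveNoI_fst (h : StabData R s v c d) (h' : StabData R s v c' d)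
    (hc : c' ∈ sArc s v.1 c) (hne : c' ≠ c) : MoveNoI h'.diagram h.diagram := by
  have a1 := h.fst v h.mem
  have a2 := h.snd v h.mem
  have a3 := h'.fst v h.mem
  have b1 := h.fst
  have b2 := h.snd
  have b3 := h'.fst
  refine moveNoI_of_exchange s s hne a2 ?_ ?_ ?_ ?_ ?_ ?_
  · intro u hu
    simp only [RectDiagram.stab_verts, mem_corners, mem_stabVerts] at *
    grind
  · intro u hu
    simp only [RectDiagram.stab_verts, mem_corners, mem_stabVerts] at *
    grind
  · simp only [RectDiagram.stab_verts]
    rw [card_stabVerts h.mem h.fst h.snd, card_stabVerts h.mem h'.fst h.snd]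
  · refine ⟨(c', v.2), (c', d), ?_, ?_, ?_⟩
    · simp [mem_corners]
    · simp [mem_corners]
    · simp only [IsEdge, RectDiagram.stab_verts, mem_stabVerts]
      grind
  · intro u hu h1 h2
    have hv := left_notMem_sArc hc (Ne.symm a3)
    have := h.empty u
    have := sArc_subset_right hc h1
    simp only [RectDiagram.stab_verts, mem_corners, mem_stabVerts] at *
    grind
  · intro u hu hu'
    simp only [RectDiagram.stab_verts, mem_stabVerts, RectDiagram.stab_sgn, RectDiagram.stab_comp,
      stabSgn, collapse] at *
    grind

theorem StabData.related_fst (h : StabData R s v c d) (h' : StabData R s v c' d) :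
    Related h.diagram h'.diagram := by
  by_cases e : c = c'
  · subst e; exact .refl
  rcases mem_sArc_total s v.1 c c' with hc | hc
  · exact Related.symm (.single (h.moveNoI_fst h' hc (Ne.symm e)))
  · exact .single (h'.moveNoI_fst h hc e)

theorem StabData.related_snd (h : StabData R s v c d) (h' : StabData R s v c d') :
    Related h.diagram h'.diagram := by
  rw [← related_transpose_iff, ← h.diagram_transpose, ← h'.diagram_transpose]
  exact h.transpose.related_fst h'.transpose

/-- Stabilizations at the same vertex and on the same side are related. -/
theorem StabData.related_same (h : StabData R s v c d) (h' : StabData R s v c' d') :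
    Related h.diagram h'.diagram := by
  rcases mem_sArc_total s v.1 c c' with hc | hc
  · have k := h.shrink_fst hc h'.fst
    exact (h.related_fst k).trans (k.related_snd h')
  · have k := h'.shrink_fst hc h.fst
    exact (h.related_snd k).trans (k.related_fst h')

/-- The meridians occupied by `R`. -/
def fsts (R : RectDiagram) : Finset Real.Angle := R.verts.image Prod.fst

/-- The longitudes occupied by `R`. -/
def snds (R : RectDiagram) : Finset Real.Angle := R.verts.image Prod.snd

theorem fst_mem_fsts {u : Torus} (hu : u ∈ R.verts) : u.1 ∈ fsts R :=
  Finset.mem_image_of_mem _ hu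

theorem snd_mem_snds {u : Torus} (hu : u ∈ R.verts) : u.2 ∈ snds R :=
  Finset.mem_image_of_mem _ hu

theorem StabData.of_near (hv : v ∈ R.verts) (hc : Near s (fsts R) v.1 c)
    (hd : Near s (snds R) v.2 d) : StabData R s v c d where
  mem := hv
  fst _ hu h := hc.notMem (h ▸ fst_mem_fsts hu)
  snd _ hu h := hd.notMem (h ▸ snd_mem_snds hu)
  empty _ hu h1 h2 := Prod.ext (hc.arc _ (fst_mem_fsts hu) h1) (hd.arc _ (snd_mem_snds hu) h2)

theorem exists_stabData (s : Bool) (hv : v ∈ R.verts) : ∃ c d, StabData R s v c d := by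
  obtain ⟨c, hc⟩ := exists_near s (fsts R) v.1
  obtain ⟨d, hd⟩ := exists_near s (snds R) v.2
  exact ⟨c, d, .of_near hv hc hd⟩

/-- Exchanging an occupied longitude `b` with a neighbouring unoccupied one `y`. -/
theorem moveNoI_swapSnd {X : RectDiagram} {b y : Real.Angle} {v w : Torus} (s : Bool)
    (hv : v ∈ X.verts) (hw : w ∈ X.verts) (hvb : v.2 = b) (hwb : w.2 = b) (hvw : v ≠ w)
    (hy : Near s (snds X) b y) : MoveNoI X (X.swapSnd b y) := by
  obtain ⟨w', hw', h1, h2, h3, h4⟩ := X.snd_ok v hv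
  have hww : w = w' := (h4 w hw (hwb.trans hvb.symm)).resolve_left hvw.symm
  subst hww
  have hyX : ∀ u ∈ X.verts, u.2 ≠ y := fun u hu e => hy.notMem (e ▸ snd_mem_snds hu)
  have hyb := hy.ne
  have hfst : v.1 ≠ w.1 := fun e => hvw (Prod.ext e (hvb.trans hwb.symm))
  refine moveNoI_of_exchange true s hfst hyb.symm ?_ ?_ ?_ ?_ ?_ ?_
  · intro u hu
    simp only [RectDiagram.mem_swapSnd, mem_corners, Equiv.swap_apply_def] at *
    grind
  · intro u hu
    simp only [RectDiagram.mem_swapSnd, mem_corners, Equiv.swap_apply_def] at *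
    grind
  · exact (Finset.card_map _).symm
  · refine ⟨v, w, ?_, ?_, hv, hw, hvw, Or.inr h2.symm⟩ <;> simp [mem_corners, hvb, hwb]
  · intro u hu g1 g2
    have g3 := hy.arc _ (snd_mem_snds hu) g2
    rcases h4 u hu (g3.trans hvb.symm) with rfl | rfl <;> simp [mem_corners, g3]
  · intro u hu hu'
    simp only [RectDiagram.mem_swapSnd, RectDiagram.swapSnd_sgn, RectDiagram.swapSnd_comp,
      Equiv.swap_apply_def] at *
    have : ¬ u.2 = b := by grind
    have : ¬ u.2 = y := by grind
    simp [*]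

/-- Stabilizations at the two ends of a horizontal edge, to the upper right of one and to the
lower left of the other, are related. -/
theorem StabData.related_horizontal (hvw : v ≠ w) (hrow : v.2 = w.2)
    (h : StabData R true v c d) (h' : StabData R false w c' d') :
    Related h.diagram h'.diagram := by
  have hv := h.mem
  have hw := h'.mem
  obtain ⟨w', hw', h1, h2, h3, h4⟩ := R.snd_ok v hv
  have hww : w = w' := (h4 w hw hrow.symm).resolve_left hvw.symm
  subst hww
  have hfst : v.1 ≠ w.1 := fun e => hvw (Prod.ext e hrow)
  obtain ⟨x, hx⟩ := exists_near true (fsts R) v.1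
  obtain ⟨e, he⟩ := exists_near true (snds R) v.2
  obtain ⟨y, hy⟩ := exists_near false (insert e (snds R)) v.2
  have hxR : ∀ u ∈ R.verts, u.1 ≠ x := fun u hu e => hx.notMem (e ▸ fst_mem_fsts hu)
  have heR : ∀ u ∈ R.verts, u.2 ≠ e := fun u hu h => he.notMem (h ▸ snd_mem_snds hu)
  have hyR : ∀ u ∈ R.verts, u.2 ≠ y :=
    fun u hu h => hy.notMem (Finset.mem_insert_of_mem (h ▸ snd_mem_snds hu))
  have hye : y ≠ e := fun h => hy.notMem (h ▸ Finset.mem_insert_self _ _)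
  have hwx : x ∈ sArc true v.1 w.1 :=
    (mem_sArc_total true v.1 x w.1).resolve_left
      fun hm => hfst (hx.arc _ (fst_mem_fsts hw) hm).symm
  have k : StabData R true v x e := .of_near hv hx he
  have k' : StabData R false w x y :=
    { mem := hw
      fst := hxR
      snd := hyR
      empty := fun u hu g1 g2 => by
        rw [← hrow] at g2
        have := hy.arc _ (Finset.mem_insert_of_mem (snd_mem_snds hu)) g2
        rcases h4 u hu this with rfl | rfl
        · exact absurd g1 (left_notMem_sArc (s := true) hwx (Ne.symm (hxR u hu)))
        · rfl }
  refine (h.related_same k).trans (Relation.ReflTransGen.trans ?_ (k'.related_same h'))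
  have a1 := hxR v hv
  have a2 := heR v hv
  have a3 := hyR v hv
  have a4 := hxR w hw
  have near1 : Near false (snds k.diagram) v.2 y := by
    refine hy.mono ?_
    intro z hz
    obtain ⟨u, hu, rfl⟩ := Finset.mem_image.1 hz
    simp only [RectDiagram.stab_verts, mem_stabVerts] at hu
    have := snd_mem_snds hv
    rw [Finset.mem_insert]
    rcases hu with rfl | rfl | rfl | ⟨hu, -⟩
    · exact Or.inl rfl
    · exact Or.inl rfl
    · exact Or.inr this
    · exact Or.inr (snd_mem_snds hu)
  have near2 : Near true (snds k'.diagram) v.2 e := by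
    refine ⟨?_, he.ne, ?_⟩
    · intro hz
      obtain ⟨u, hu, hue⟩ := Finset.mem_image.1 hz
      simp only [RectDiagram.stab_verts, mem_stabVerts] at hu
      grind
    · intro z hz hze
      obtain ⟨u, hu, rfl⟩ := Finset.mem_image.1 hz
      simp only [RectDiagram.stab_verts, mem_stabVerts] at hu
      rcases hu with rfl | rfl | rfl | ⟨hu, -⟩
      · exact absurd (mem_sArc_not hze hy.ne) fun hm =>
          he.ne (hy.arc _ (Finset.mem_insert_self _ _) hm)
      · exact absurd (mem_sArc_not hze hy.ne) fun hm =>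
          he.ne (hy.arc _ (Finset.mem_insert_self _ _) hm)
      · exact hrow.symm
      · exact he.arc _ (snd_mem_snds hu) hze
  have hne := he.ne
  have hny := hy.ne
  have m1 : MoveNoI k.diagram (k.diagram.swapSnd v.2 y) := by
    refine moveNoI_swapSnd (v := (x, v.2)) (w := w) false ?_ ?_ rfl hrow.symm ?_ near1
    · simp [mem_stabVerts]
    · simp only [RectDiagram.stab_verts, mem_stabVerts]
      exact Or.inr (Or.inr (Or.inr ⟨hw, hvw.symm⟩))
    · exact fun h => a4 (congrArg Prod.fst h).symm
  have m2 : MoveNoI k'.diagram (k'.diagram.swapSnd v.2 e) := by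
    refine moveNoI_swapSnd (v := (x, v.2)) (w := v) true ?_ ?_ rfl rfl ?_ near2
    · simp [mem_stabVerts, hrow]
    · simp only [RectDiagram.stab_verts, mem_stabVerts]
      exact Or.inr (Or.inr (Or.inr ⟨hv, hvw⟩))
    · exact fun h => a1 (congrArg Prod.fst h).symm
  have hag : Agree (k.diagram.swapSnd v.2 y) (k'.diagram.swapSnd v.2 e) := by
    have hcomp : R.comp v = R.comp w := R.comp_eq_of_adj ⟨hv, hw, Or.inr hrow⟩
    have hmem : ∀ u, u ∈ (k.diagram.swapSnd v.2 y).verts ↔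
        u ∈ (k'.diagram.swapSnd v.2 e).verts := by
      rintro ⟨p, q⟩
      simp only [RectDiagram.mem_swapSnd, RectDiagram.stab_verts, mem_stabVerts,
        Equiv.swap_apply_def]
      grind
    refine ⟨Finset.ext hmem, ?_⟩
    rintro ⟨p, q⟩ hu
    clear hmem near1 near2 m1 m2
    have cases : p = v.1 ∧ q = e ∨ p = x ∧ q = e ∨ p = x ∧ q = y ∨ p = w.1 ∧ q = y ∨
        (q ≠ v.2 ∧ q ≠ y ∧ q ≠ e) := by
      simp only [RectDiagram.mem_swapSnd, RectDiagram.stab_verts, mem_stabVerts,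
        Equiv.swap_apply_def] at hu
      grind
    clear hu
    have hsg : R.sgn w = !R.sgn v := by cases hs : R.sgn v <;> cases hs' : R.sgn w <;> simp_all
    have b2 : w = (w.1, v.2) := by rw [hrow]
    simp only [RectDiagram.swapSnd_sgn, RectDiagram.swapSnd_comp, RectDiagram.stab_sgn,
      RectDiagram.stab_comp, stabSgn, collapse, Equiv.swap_apply_def, Prod.mk.injEq, ← hrow]
    rcases cases with ⟨rfl, rfl⟩ | ⟨rfl, rfl⟩ | ⟨rfl, rfl⟩ | ⟨rfl, rfl⟩ | ⟨c1, c2, c3⟩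
    · simp [hne, a3, hye.symm, a1, hfst, hcomp]
    · simp [hne, a3, hye.symm, hsg, hcomp]
    · simp [hny, hye, a2, hsg, hcomp]
    · simp [hny, hye, a4, a2, Ne.symm hfst, ← b2]
    · simp [c1, c2, c3]
  exact .head m1 (.single (m2.symm.congr hag))

theorem StabData.related_vertical (hvw : v ≠ w) (hcol : v.1 = w.1)
    (h : StabData R true v c d) (h' : StabData R false w c' d') :
    Related h.diagram h'.diagram := by
  rw [← related_transpose_iff, ← h.diagram_transpose, ← h'.diagram_transpose]
  exact h.transpose.related_horizontal (fun e => hvw (Prod.swap_injective e)) hcol h'.transpose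

/-- The oriented type of a stabilization at a vertex of sign `b`. -/
def otype (s b : Bool) : OType := if s = b then .negI else .posI

theorem StabData.related_adj {s' : Bool} (hvw : Adj R.verts v w) (h : StabData R s v c d)
    (h' : StabData R s' w c' d') (ht : otype s (R.sgn v) = otype s' (R.sgn w)) :
    Related h.diagram h'.diagram := by
  by_cases e : v = w
  · subst e
    have : s = s' := by
      unfold otype at ht
      cases s <;> cases s' <;> cases hs : R.sgn v <;> simp_all
    subst this
    exact h.related_same h'
  have hsg : R.sgn v ≠ R.sgn w := by
    rcases hvw with ⟨hv, hw, hr | hr⟩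
    · obtain ⟨w', -, -, h2, h3, h4⟩ := R.fst_ok v hv
      rcases h4 w hw hr.symm with rfl | rfl
      · exact absurd rfl e
      · grind
    · obtain ⟨w', -, -, h2, h3, h4⟩ := R.snd_ok v hv
      rcases h4 w hw hr.symm with rfl | rfl
      · exact absurd rfl e
      · grind
  have hs : s = !s' := by
    unfold otype at ht
    cases s <;> cases s' <;> cases hs : R.sgn v <;> cases hs' : R.sgn w <;> simp_all
  subst hs
  obtain ⟨-, -, hr⟩ := hvw
  cases s'
  · rcases hr with hr | hr
    · exact h.related_vertical e hr h'
    · exact h.related_horizontal e hr h'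
  · rcases hr with hr | hr
    · exact Related.symm (h'.related_vertical (Ne.symm e) hr.symm h)
    · exact Related.symm (h'.related_horizontal (Ne.symm e) hr.symm h)

/-- For every vertex there is a side on which a stabilization has the prescribed type. -/
theorem exists_otype {t : OType} (ht : t.isI = true) (b : Bool) : ∃ s, t = otype s b := by
  cases t <;> cases b <;> simp [OType.isI, otype] at *

/-- Type I stabilizations of the same oriented type on the same component are related. -/
theorem StabData.related {s' : Bool} (hvw : R.comp v = R.comp w) (h : StabData R s v c d)
    (h' : StabData R s' w c' d') (ht : otype s (R.sgn v) = otype s' (R.sgn w)) :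
    Related h.diagram h'.diagram := by
  have hconn := (R.comp_eq_iff_conn h.mem h'.mem).1 hvw
  have hw := h'.mem
  clear hvw
  induction hconn generalizing s' c' d' with
  | refl =>
    have : s = s' := by
      unfold otype at ht
      cases s <;> cases s' <;> cases hs : R.sgn v <;> simp_all
    subst this
    exact h.related_same h'
  | @tail y z _ hyz ih =>
    obtain ⟨s₁, hs₁⟩ := exists_otype (t := otype s (R.sgn v)) (by unfold otype; split <;> rfl)
      (R.sgn y)
    obtain ⟨c₁, d₁, h₁⟩ := exists_stabData s₁ hyz.1
    exact (ih h₁ hs₁ hyz.1).trans (h₁.related_adj hyz h' (hs₁.symm.trans ht))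

end WellDefined

section Characterization

theorem bool_eq_of_ne_of_ne {a b c : Bool} (h : a ≠ b) (h' : b ≠ c) : a = c := by
  revert a b c; decide

variable {R A : RectDiagram} {s : Bool} {v : Torus} {c d : Real.Angle}

theorem StabData.kindOk (h : StabData R s v c d) :
    KindOk R h.diagram (.stab (otype s (R.sgn v)) (R.comp v)) := by
  have hv := h.mem
  have hc := h.fst v hv
  have hd := h.snd v hv
  have hne : ∀ u ∈ R.verts, ¬ (u = (v.1, d) ∨ u = (c, d) ∨ u = (c, v.2)) := by
    rintro u hu (rfl | rfl | rfl)
    · exact h.snd _ hu rfl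
    · exact h.fst _ hu rfl
    · exact h.fst _ hu rfl
  have hvn : v ∉ h.diagram.verts := by
    rw [RectDiagram.stab_verts, mem_stabVerts]
    have := hne v hv
    tauto
  have m1 : (v.1, d) ∈ h.diagram.verts := by simp [mem_stabVerts]
  have m2 : (c, d) ∈ h.diagram.verts := by simp [mem_stabVerts]
  have m3 : (c, v.2) ∈ h.diagram.verts := by simp [mem_stabVerts]
  have hdiff : ∀ u, u ∈ corners v.1 c v.2 d ↔
      (u ∈ R.verts ∧ u ∉ h.diagram.verts ∨ u ∈ h.diagram.verts ∧ u ∉ R.verts) := by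
    intro u
    have h1 : u ∈ corners v.1 c v.2 d ↔ u = v ∨ (u = (v.1, d) ∨ u = (c, d) ∨ u = (c, v.2)) := by
      simp only [mem_corners, Prod.ext_iff]
      tauto
    rw [h1, RectDiagram.stab_verts, mem_stabVerts]
    by_cases huv : u = v
    · rw [huv]
      have g := hne v hv
      simp [hv, g]
    · by_cases hu : u ∈ R.verts
      · have g := hne u hu
        simp [hu, huv, g]
      · simp [hu, huv]
  have hedge : ∃ u w, u ∈ corners v.1 c v.2 d ∧ w ∈ corners v.1 c v.2 d ∧
      (IsEdge R u w ∨ IsEdge h.diagram u w) := by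
    refine ⟨(v.1, d), (c, d), ?_, ?_, Or.inr ⟨m1, m2, ?_, Or.inr rfl⟩⟩
    · simp [mem_corners]
    · simp [mem_corners]
    · exact fun e => hc (congrArg Prod.fst e)
  have hn1 : ¬ R.verts ⊆ h.diagram.verts := fun hs => hvn (hs hv)
  have hn2 : ¬ h.diagram.verts ⊆ R.verts := fun hs => h.fst _ (hs m2) rfl
  have hemp : ∀ u, u ∈ R.verts ∨ u ∈ h.diagram.verts → u.1 ∈ sArc s v.1 c →
      u.2 ∈ sArc s v.2 d → u ∈ corners v.1 c v.2 d := by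
    intro u hu h1 h2
    by_contra hu'
    have := hdiff u
    have huR : u ∈ R.verts := by tauto
    have := h.empty u huR h1 h2
    subst this
    exact hu' (by simp [mem_corners])
  have hag : ∀ u, u ∈ R.verts → u ∈ h.diagram.verts →
      R.sgn u = h.diagram.sgn u ∧ R.comp u = h.diagram.comp u := by
    intro u hu _
    have := hne u hu
    simp only [RectDiagram.stab_sgn, RectDiagram.stab_comp, stabSgn, collapse, this, if_false]
    rw [if_neg (by tauto)]
    simp
  have hcard : h.diagram.verts.card = R.verts.card + 2 :=
    card_stabVerts hv h.fst h.snd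
  have hI : ∀ u ∈ R.verts, u ∈ corners v.1 c v.2 d → u = v := by
    intro u hu hc
    have := (hdiff u).1 hc
    rw [RectDiagram.stab_verts, mem_stabVerts] at this
    tauto
  refine ⟨?_, v, hv, hvn, rfl⟩
  cases s
  · refine ⟨c, v.1, d, v.2, ⟨isElemMoveWith_iff.2 ?_, hcard⟩, d, Or.inl rfl, m2, m1, ?_⟩
    · rw [corners_comm_fst, corners_comm_snd]
      exact ⟨hc.symm, hd.symm, hdiff, hedge, hn1, hn2, hemp, hag⟩
    · have hT : TypeICornerCond R c v.1 d v.2 := fun u hu hcr => by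
        rw [corners_comm_fst, corners_comm_snd] at hcr
        exact Or.inr (hI u hu hcr)
      cases hs : R.sgn v <;> refine ⟨hT, ?_⟩ <;> simp [stabSgn, collapse, hc, hs]
  · refine ⟨v.1, c, v.2, d, ⟨isElemMoveWith_iff.2 ?_, hcard⟩, d, Or.inr rfl, m1, m2, ?_⟩
    · exact ⟨hc, hd, hdiff, hedge, hn1, hn2, hemp, hag⟩
    · have hT : TypeICornerCond R v.1 c v.2 d := fun u hu hcr => Or.inl (hI u hu hcr)
      cases hs : R.sgn v <;> refine ⟨hT, ?_⟩ <;> simp [stabSgn, hs]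

theorem StabData.related_of_agree (h : StabData R s v c d) (hA : Agree A h.diagram) :
    Related A h.diagram := by
  obtain ⟨x, hx⟩ := exists_near s (insert c (fsts R)) v.1
  have hxc : x ≠ c := fun e => hx.notMem (e ▸ Finset.mem_insert_self _ _)
  have hxR : ∀ u ∈ R.verts, u.1 ≠ x := fun u hu e =>
    hx.notMem (Finset.mem_insert_of_mem (e ▸ fst_mem_fsts hu))
  have hm : x ∈ sArc s v.1 c := (mem_sArc_total s v.1 c x).resolve_right fun hm =>
    h.fst v h.mem (hx.arc _ (Finset.mem_insert_self _ _) hm).symm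
  have k := h.shrink_fst hm hxR
  have m := h.moveNoI_fst k hm hxc
  exact .head (m.symm.congr hA) (.single m)

/-- A diagram having the vertices of a stabilization of `R` is that stabilization. -/
theorem agree_stab (hv : v ∈ R.verts) (hvc : v.1 ≠ c) (hvd : v.2 ≠ d)
    (hA : ∀ u, u ∈ A.verts ↔ u ∈ stabVerts R.verts v c d)
    (h1 : (v.1, d) ∉ R.verts) (h2 : (c, d) ∉ R.verts) (h3 : (c, v.2) ∉ R.verts)
    (hag : ∀ u, u ∈ R.verts → u ∈ A.verts → R.sgn u = A.sgn u ∧ R.comp u = A.comp u) :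
    ∃ (hc : ∀ u ∈ R.verts, u.1 ≠ c) (hd : ∀ u ∈ R.verts, u.2 ≠ d),
      Agree A (R.stab v c d hv hc hd) := by
  have n1 : (v.1, d) ∈ A.verts := by simp [hA, mem_stabVerts]
  have n2 : (c, d) ∈ A.verts := by simp [hA, mem_stabVerts]
  have n3 : (c, v.2) ∈ A.verts := by simp [hA, mem_stabVerts]
  have hRA : ∀ u ∈ R.verts, u ≠ v → u ∈ A.verts := by
    intro u hu huv
    rw [hA, mem_stabVerts]
    tauto
  have e23 : (c, d) ≠ (c, v.2) := fun e => hvd (congrArg Prod.snd e).symm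
  have e21 : (c, d) ≠ (v.1, d) := fun e => hvc (congrArg Prod.fst e).symm
  have hc : ∀ u ∈ R.verts, u.1 ≠ c := by
    intro u hu e
    have huA := hRA u hu (by rintro rfl; exact hvc e)
    obtain ⟨w, -, -, -, -, h⟩ := A.fst_ok _ huA
    have a := h _ n2 e.symm
    have b := h _ n3 e.symm
    have a' : (c, d) ≠ u := by rintro rfl; exact h2 hu
    have b' : (c, v.2) ≠ u := by rintro rfl; exact h3 hu
    exact e23 ((a.resolve_left a').trans (b.resolve_left b').symm)
  have hd : ∀ u ∈ R.verts, u.2 ≠ d := by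
    intro u hu e
    have huA := hRA u hu (by rintro rfl; exact hvd e)
    obtain ⟨w, -, -, -, -, h⟩ := A.snd_ok _ huA
    have a := h _ n2 e.symm
    have b := h _ n1 e.symm
    have a' : (c, d) ≠ u := by rintro rfl; exact h2 hu
    have b' : (v.1, d) ≠ u := by rintro rfl; exact h1 hu
    exact e21 ((a.resolve_left a').trans (b.resolve_left b').symm)
  have opp_fst : ∀ x ∈ A.verts, ∀ y ∈ A.verts, x ≠ y → x.1 = y.1 → A.sgn x ≠ A.sgn y := by
    intro x hx y hy hxy e
    obtain ⟨w, -, -, -, hs, h⟩ := A.fst_ok _ hx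
    obtain rfl := (h y hy e.symm).resolve_left hxy.symm
    exact hs.symm
  have opp_snd : ∀ x ∈ A.verts, ∀ y ∈ A.verts, x ≠ y → x.2 = y.2 → A.sgn x ≠ A.sgn y := by
    intro x hx y hy hxy e
    obtain ⟨w, -, -, -, hs, h⟩ := A.snd_ok _ hx
    obtain rfl := (h y hy e.symm).resolve_left hxy.symm
    exact hs.symm
  have q3 : A.sgn (c, v.2) = R.sgn v ∧ A.comp (c, v.2) = R.comp v := by
    obtain ⟨w, hw, hwv, hr, hs, -⟩ := R.snd_ok _ hv
    have hwA := hRA w hw hwv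
    obtain ⟨g1, g2⟩ := hag w hw hwA
    have o := opp_snd _ n3 _ hwA (by rintro rfl; exact h3 hw) hr.symm
    have k1 := A.comp_eq_of_adj (u := (c, v.2)) (v := w) ⟨n3, hwA, Or.inr hr.symm⟩
    have k2 := R.comp_eq_of_adj ⟨hw, hv, Or.inr hr⟩
    refine ⟨?_, k1.trans (g2.symm.trans k2)⟩
    rw [← g1] at o
    exact bool_eq_of_ne_of_ne o hs
  have q1 : A.sgn (v.1, d) = R.sgn v ∧ A.comp (v.1, d) = R.comp v := by
    obtain ⟨w, hw, hwv, hr, hs, -⟩ := R.fst_ok _ hv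
    have hwA := hRA w hw hwv
    obtain ⟨g1, g2⟩ := hag w hw hwA
    have o := opp_fst _ n1 _ hwA (by rintro rfl; exact h1 hw) hr.symm
    have k1 := A.comp_eq_of_adj (u := (v.1, d)) (v := w) ⟨n1, hwA, Or.inl hr.symm⟩
    have k2 := R.comp_eq_of_adj ⟨hw, hv, Or.inl hr⟩
    refine ⟨?_, k1.trans (g2.symm.trans k2)⟩
    rw [← g1] at o
    exact bool_eq_of_ne_of_ne o hs
  have q2 : A.sgn (c, d) = !R.sgn v ∧ A.comp (c, d) = R.comp v := by
    have o := opp_fst _ n2 _ n3 e23 rfl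
    have k1 := A.comp_eq_of_adj (u := (c, d)) (v := (c, v.2)) ⟨n2, n3, Or.inl rfl⟩
    refine ⟨?_, k1.trans q3.2⟩
    rw [q3.1] at o
    exact Bool.eq_not.2 o
  refine ⟨hc, hd, Finset.ext fun u => by rw [hA]; rfl, fun u hu => ?_⟩
  rw [hA, mem_stabVerts] at hu
  simp only [RectDiagram.stab_sgn, RectDiagram.stab_comp, stabSgn, collapse]
  rcases hu with rfl | rfl | rfl | ⟨hu, huv⟩
  · simpa [hvc] using q1
  · simpa using q2
  · simpa [hvd] using q3
  · have g1 : u ≠ (v.1, d) := by rintro rfl; exact h1 hu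
    have g2 : u ≠ (c, d) := by rintro rfl; exact h2 hu
    have g3 : u ≠ (c, v.2) := by rintro rfl; exact h3 hu
    obtain ⟨f1, f2⟩ := hag u hu (hRA u hu huv)
    simp [g1, g2, g3, f1, f2]

theorem card_corners {t1 t2 p1 p2 : Real.Angle} (ht : t1 ≠ t2) (hp : p1 ≠ p2) :
    (corners t1 t2 p1 p2).card = 4 := by
  unfold corners
  rw [Finset.card_insert_of_notMem, Finset.card_insert_of_notMem, Finset.card_insert_of_notMem,
    Finset.card_singleton] <;> simp [ht, hp]

theorem IsStabWith.eq_of_removed {t1 t2 p1 p2 : Real.Angle} (h : IsStabWith R A t1 t2 p1 p2)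
    {u w : Torus} (hu : u ∈ R.verts) (hu' : u ∉ A.verts) (hw : w ∈ R.verts) (hw' : w ∉ A.verts) :
    u = w := by
  obtain ⟨⟨ht, hp, hs, -⟩, hcard⟩ := h
  have h4 := card_corners ht hp
  rw [← hs, symmDiff_def, Finset.sup_eq_union,
    Finset.card_union_of_disjoint disjoint_sdiff_sdiff] at h4
  have e1 := Finset.card_sdiff_add_card_inter R.verts A.verts
  have e2 := Finset.card_sdiff_add_card_inter A.verts R.verts
  rw [Finset.inter_comm] at e2
  have h1 : (R.verts \ A.verts).card ≤ 1 := by omega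
  exact Finset.card_le_one.1 h1 u (Finset.mem_sdiff.2 ⟨hu, hu'⟩) w (Finset.mem_sdiff.2 ⟨hw, hw'⟩)

theorem IsStabWith.exists_stabData {t1 t2 p1 p2 : Real.Angle} (h : IsStabWith R A t1 t2 p1 p2)
    (hv : v ∈ R.verts) (hvA : v ∉ A.verts) (s : Bool) (hvc : v.1 ≠ c) (hvd : v.2 ≠ d)
    (hcor : corners t1 t2 p1 p2 = corners v.1 c v.2 d)
    (ha : Arc t1 t2 = sArc s v.1 c) (hb : Arc p1 p2 = sArc s v.2 d) :
    ∃ h : StabData R s v c d, Agree A h.diagram := by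
  have h1 : ∀ u, u ∈ corners v.1 c v.2 d → u ≠ v → u ∈ A.verts ∧ u ∉ R.verts := by
    intro u hu huv
    have hm := (isElemMoveWith_iff.1 h.1).2.2.1 u
    rw [hcor] at hm
    rcases hm.1 hu with ⟨g1, g2⟩ | g
    · exact absurd (h.eq_of_removed g1 g2 hv hvA) huv
    · exact g
  have h2 : ∀ u, u ∉ corners v.1 c v.2 d → (u ∈ A.verts ↔ u ∈ R.verts) := by
    intro u hu
    have hm := (isElemMoveWith_iff.1 h.1).2.2.1 u
    rw [hcor] at hm
    tauto
  obtain ⟨-, -, -, -, -, -, hemp, hag⟩ := isElemMoveWith_iff.1 h.1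
  have e1 : (v.1, d) ≠ v := fun e => hvd (congrArg Prod.snd e).symm
  have e2 : (c, d) ≠ v := fun e => hvc (congrArg Prod.fst e).symm
  have e3 : (c, v.2) ≠ v := fun e => hvc (congrArg Prod.fst e).symm
  have g1 := h1 (v.1, d) (by simp [mem_corners]) e1
  have g2 := h1 (c, d) (by simp [mem_corners]) e2
  have g3 := h1 (c, v.2) (by simp [mem_corners]) e3
  have hA : ∀ u, u ∈ A.verts ↔ u ∈ stabVerts R.verts v c d := by
    intro u
    rw [mem_stabVerts]
    by_cases k1 : u = (v.1, d)
    · simp [k1, g1]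
    by_cases k2 : u = (c, d)
    · simp [k2, g2]
    by_cases k3 : u = (c, v.2)
    · simp [k3, g3]
    by_cases k4 : u = v
    · rw [k4] at k1 k2 k3 ⊢
      simp [hvA, k1, k2, k3]
    have : u ∉ corners v.1 c v.2 d := by
      simp only [mem_corners, Prod.ext_iff] at *
      tauto
    rw [h2 u this]
    simp [k1, k2, k3, k4]
  obtain ⟨hc, hd, hag'⟩ := agree_stab hv hvc hvd hA g1.2 g2.2 g3.2 hag
  refine ⟨⟨hv, hc, hd, fun u hu a1 a2 => ?_⟩, hag'⟩
  rw [← ha] at a1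
  rw [← hb] at a2
  have hu' := hemp u (Or.inl hu) a1 a2
  rw [hcor] at hu'
  by_contra huv
  exact (h1 u hu' huv).2 hu

/-- Every type I stabilization is given by a vertex, a side and a sufficiently small rectangle. -/
theorem exists_stabData_of_kindOk {t : OType} {i : ℕ} (ht : t.isI = true)
    (h : KindOk R A (.stab t i)) :
    ∃ s v c d, ∃ h : StabData R s v c d,
      R.comp v = i ∧ t = otype s (R.sgn v) ∧ Agree A h.diagram := by
  obtain ⟨⟨t1, t2, p1, p2, hw, p0, hp0, m1, m2, hm⟩, v, hv, hvA, rfl⟩ := h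
  obtain ⟨h1, h2, h3, -⟩ := isElemMoveWith_iff.1 hw.1
  have hvc : v ∈ corners t1 t2 p1 p2 := (h3 v).2 (Or.inl ⟨hv, hvA⟩)
  have hI : TypeICornerCond R t1 t2 p1 p2 := by
    cases t <;> first | exact hm.1 | exact absurd ht (by decide)
  have hsg : t = if A.sgn (t2, p0) then .posI else .negI := by
    cases t <;> simp [OType.isI] at * <;> simp [hm.2]
  rcases hI v hv hvc with rfl | rfl
  · obtain ⟨k, hk⟩ := hw.exists_stabData hv hvA true h1 h2 rfl rfl rfl
    refine ⟨true, _, _, _, k, rfl, ?_, hk⟩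
    have hp : p0 = p2 := hp0.resolve_left (by rintro rfl; exact hvA m1)
    subst hp
    rw [hsg, (hk.2 _ m2).1]
    cases e : R.sgn (t1, p1) <;> simp [stabSgn, otype, e]
  · obtain ⟨k, hk⟩ := hw.exists_stabData (v := (t2, p2)) hv hvA false h1.symm h2.symm
      (by rw [corners_comm_fst, corners_comm_snd]) rfl rfl
    refine ⟨false, _, _, _, k, rfl, ?_, hk⟩
    have hp : p0 = p1 := hp0.resolve_right (by rintro rfl; exact hvA m2)
    subst hp
    rw [hsg, (hk.2 _ m2).1]
    cases e : R.sgn (t2, p2) <;> simp [stabSgn, collapse, otype, e, h1.symm]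

/-- Two type I stabilizations of one diagram having the same kind are related. -/
theorem related_of_kindOk {B : RectDiagram} {t : OType} {i : ℕ} (ht : t.isI = true)
    (hA : KindOk R A (.stab t i)) (hB : KindOk R B (.stab t i)) : Related A B := by
  obtain ⟨s, v, c, d, h, h1, h2, h3⟩ := exists_stabData_of_kindOk ht hA
  obtain ⟨s', v', c', d', h', h1', h2', h3'⟩ := exists_stabData_of_kindOk ht hB
  exact ((h.related_of_agree h3).trans
    (h.related (h1.trans h1'.symm) h' (h2.symm.trans h2'))).trans
    (Related.symm (h'.related_of_agree h3'))

end Characterization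

section Commutation

variable {R₁ R₂ : RectDiagram} {s : Bool} {v : Torus} {x y : Real.Angle}

theorem StabData.not_new {R : RectDiagram} (h : StabData R s v x y) {u : Torus}
    (hu : u ∈ R.verts) : ¬ (u = (v.1, y) ∨ u = (x, y) ∨ u = (x, v.2)) := by
  rintro (rfl | rfl | rfl)
  · exact h.snd _ hu rfl
  · exact h.fst _ hu rfl
  · exact h.fst _ hu rfl

theorem StabData.sgn_of_mem {R : RectDiagram} (h : StabData R s v x y) {u : Torus}
    (hu : u ∈ R.verts) : h.diagram.sgn u = R.sgn u := by
  have := h.not_new hu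
  have h2 : u ≠ (x, y) := fun e => this (Or.inr (Or.inl e))
  rw [RectDiagram.stab_sgn, stabSgn, collapse, if_neg h2, if_neg this]

theorem StabData.comp_of_mem {R : RectDiagram} (h : StabData R s v x y) {u : Torus}
    (hu : u ∈ R.verts) : h.diagram.comp u = R.comp u := by
  simp [collapse, h.not_new hu]

/-- The same small stabilization performed on two diagrams sharing the vertex `v`. -/
structure CommonStab (R₁ R₂ : RectDiagram) (s : Bool) (v : Torus) (x y : Real.Angle) : Prop where
  mem₁ : v ∈ R₁.verts
  mem₂ : v ∈ R₂.verts
  sgn : R₁.sgn v = R₂.sgn v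
  comp : R₁.comp v = R₂.comp v
  fst : Near s (fsts R₁ ∪ fsts R₂) v.1 x
  snd : Near s (snds R₁ ∪ snds R₂) v.2 y

theorem exists_commonStab (s : Bool) (h₁ : v ∈ R₁.verts) (h₂ : v ∈ R₂.verts)
    (hs : R₁.sgn v = R₂.sgn v) (hc : R₁.comp v = R₂.comp v) :
    ∃ x y, CommonStab R₁ R₂ s v x y := by
  obtain ⟨x, hx⟩ := exists_near s (fsts R₁ ∪ fsts R₂) v.1
  obtain ⟨y, hy⟩ := exists_near s (snds R₁ ∪ snds R₂) v.2
  exact ⟨x, y, h₁, h₂, hs, hc, hx, hy⟩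

namespace CommonStab

theorem data₁ (h : CommonStab R₁ R₂ s v x y) : StabData R₁ s v x y :=
  .of_near h.mem₁ (h.fst.mono Finset.subset_union_left) (h.snd.mono Finset.subset_union_left)

theorem data₂ (h : CommonStab R₁ R₂ s v x y) : StabData R₂ s v x y :=
  .of_near h.mem₂ (h.fst.mono Finset.subset_union_right) (h.snd.mono Finset.subset_union_right)

theorem symm (h : CommonStab R₁ R₂ s v x y) : CommonStab R₂ R₁ s v x y where
  mem₁ := h.mem₂
  mem₂ := h.mem₁
  sgn := h.sgn.symm
  comp := h.comp.symm
  fst := by rw [Finset.union_comm]; exact h.fst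
  snd := by rw [Finset.union_comm]; exact h.snd

theorem mem_iff {R : RectDiagram} (k : StabData R s v x y) {u : Torus} :
    u ∈ k.diagram.verts ↔ (u = (v.1, y) ∨ u = (x, y) ∨ u = (x, v.2)) ∨ (u ∈ R.verts ∧ u ≠ v) := by
  rw [RectDiagram.stab_verts, mem_stabVerts]
  tauto

theorem mem_and_notMem_iff (h : CommonStab R₁ R₂ s v x y) (u : Torus) :
    (u ∈ h.data₁.diagram.verts ∧ u ∉ h.data₂.diagram.verts) ↔ (u ∈ R₁.verts ∧ u ∉ R₂.verts) := by
  rw [mem_iff, mem_iff]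
  by_cases hu : u = (v.1, y) ∨ u = (x, y) ∨ u = (x, v.2)
  · have : u ∉ R₁.verts := fun g => h.data₁.not_new g hu
    simp [hu, this]
  · by_cases huv : u = v
    · have h₁ := h.mem₁
      have h₂ := h.mem₂
      rw [← huv] at h₁ h₂
      exact iff_of_false (fun g => (g.1.resolve_left hu).2 huv) (fun g => g.2 h₂)
    · simp [hu, huv]

theorem subset_iff (h : CommonStab R₁ R₂ s v x y) :
    h.data₁.diagram.verts ⊆ h.data₂.diagram.verts ↔ R₁.verts ⊆ R₂.verts := by
  constructor
  · intro g u hu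
    by_contra hn
    have := (h.mem_and_notMem_iff u).2 ⟨hu, hn⟩
    exact this.2 (g this.1)
  · intro g u hu
    by_contra hn
    have := (h.mem_and_notMem_iff u).1 ⟨hu, hn⟩
    exact this.2 (g this.1)

/-- The rectangles of moves between the diagrams and between their stabilizations both have
corners among the vertices occurring in exactly one of the diagrams. -/
theorem mem_iff_of_corner (h : CommonStab R₁ R₂ s v x y) {u : Torus}
    (hu : u ∈ R₁.verts ∧ u ∉ R₂.verts ∨ u ∈ R₂.verts ∧ u ∉ R₁.verts) :
    u ∈ h.data₁.diagram.verts ↔ u ∈ R₁.verts := by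
  rcases hu with ⟨h1, h2⟩ | ⟨h1, h2⟩
  · exact iff_of_true ((h.mem_and_notMem_iff u).2 ⟨h1, h2⟩).1 h1
  · exact iff_of_false ((h.symm.mem_and_notMem_iff u).2 ⟨h1, h2⟩).2 h2

theorem isElemMoveWith_iff (h : CommonStab R₁ R₂ s v x y) {t1 t2 p1 p2 : Real.Angle} :
    IsElemMoveWith h.data₁.diagram h.data₂.diagram t1 t2 p1 p2 ↔
      IsElemMoveWith R₁ R₂ t1 t2 p1 p2 := by
  rw [RectDiag.isElemMoveWith_iff, RectDiag.isElemMoveWith_iff, h.subset_iff, h.symm.subset_iff]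
  simp only [h.mem_and_notMem_iff, h.symm.mem_and_notMem_iff]
  refine and_congr_right fun ht => and_congr_right fun hp => and_congr_right fun hcor => ?_
  have hedge : ∀ u w, u ∈ corners t1 t2 p1 p2 ∧ w ∈ corners t1 t2 p1 p2 ∧
      (IsEdge h.data₁.diagram u w ∨ IsEdge h.data₂.diagram u w) ↔
      u ∈ corners t1 t2 p1 p2 ∧ w ∈ corners t1 t2 p1 p2 ∧ (IsEdge R₁ u w ∨ IsEdge R₂ u w) := by
    intro u w
    refine and_congr_right fun hu => and_congr_right fun hw => ?_
    rw [hcor] at hu hw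
    unfold IsEdge
    rw [h.mem_iff_of_corner hu, h.mem_iff_of_corner hw, h.symm.mem_iff_of_corner hu.symm,
      h.symm.mem_iff_of_corner hw.symm]
  simp only [hedge]
  refine and_congr_right fun _ => and_congr_right fun _ => and_congr_right fun _ => ?_
  have hF : ∀ u ∈ corners t1 t2 p1 p2,
      u.1 ∈ fsts R₁ ∪ fsts R₂ ∧ u.2 ∈ snds R₁ ∪ snds R₂ := by
    intro u hu
    rw [Finset.mem_union, Finset.mem_union]
    rcases (hcor u).1 hu with g | g
    · exact ⟨Or.inl (fst_mem_fsts g.1), Or.inl (snd_mem_snds g.1)⟩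
    · exact ⟨Or.inr (fst_mem_fsts g.1), Or.inr (snd_mem_snds g.1)⟩
  obtain ⟨ft1, fp1⟩ := hF (t1, p1) (by simp [mem_corners])
  obtain ⟨ft2, fp2⟩ := hF (t2, p2) (by simp [mem_corners])
  have hv1 := h.mem₁
  have hv2 := h.mem₂
  have hvc : v ∉ corners t1 t2 p1 p2 := by
    rw [hcor]
    tauto
  have hx : ∀ z, (x, z) ∉ corners t1 t2 p1 p2 := fun z hz => h.fst.notMem (hF _ hz).1
  have hy : ∀ z, (z, y) ∉ corners t1 t2 p1 p2 := fun z hz => h.snd.notMem (hF _ hz).2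
  refine and_congr ?_ ?_
  · constructor
    · intro g u hu a b
      by_cases huv : u = v
      · subst huv
        by_cases k1 : u.1 = t1 ∨ u.1 = t2
        · by_cases k2 : u.2 = p1 ∨ u.2 = p2
          · exact mem_corners.2 ⟨k1, k2⟩
          · rw [not_or] at k2
            refine absurd (g (u.1, y) (Or.inl ((mem_iff _).2 (by simp))) a ?_) (hy _)
            exact h.snd.mem_Arc fp1 fp2 k2.1 k2.2 b
        · rw [not_or] at k1
          refine absurd (g (x, u.2) (Or.inl ((mem_iff _).2 (by simp))) ?_ b) (hx _)
          exact h.fst.mem_Arc ft1 ft2 k1.1 k1.2 a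
      · exact g u (hu.imp (fun hu => (mem_iff _).2 (Or.inr ⟨hu, huv⟩))
          (fun hu => (mem_iff _).2 (Or.inr ⟨hu, huv⟩))) a b
    · intro g u hu a b
      have hv' : v.1 ∈ Arc t1 t2 → v.2 ∈ Arc p1 p2 → False :=
        fun a b => hvc (g v (Or.inl hv1) a b)
      have hu' : (u = (v.1, y) ∨ u = (x, y) ∨ u = (x, v.2)) ∨
          (u ∈ R₁.verts ∨ u ∈ R₂.verts) := by
        rw [mem_iff, mem_iff] at hu
        tauto
      rcases hu' with (rfl | rfl | rfl) | hu'
      · exact (hv' a (h.snd.mem_Arc_of_mem fp1 fp2 b)).elim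
      · exact (hv' (h.fst.mem_Arc_of_mem ft1 ft2 a) (h.snd.mem_Arc_of_mem fp1 fp2 b)).elim
      · exact (hv' (h.fst.mem_Arc_of_mem ft1 ft2 a) b).elim
      · exact g u hu' a b
  · refine forall_congr' fun u => ?_
    by_cases hu : u = (v.1, y) ∨ u = (x, y) ∨ u = (x, v.2)
    · have n1 : u ∉ R₁.verts := fun g => h.data₁.not_new g hu
      simp only [n1, false_imp_iff, iff_true]
      intro _ _
      simp only [RectDiagram.stab_sgn, RectDiagram.stab_comp, stabSgn, collapse, hu, if_true,
        h.sgn, h.comp, and_self]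
    · by_cases huv : u = v
      · refine iff_of_true (fun g => ?_) (fun _ _ => huv ▸ ⟨h.sgn, h.comp⟩)
        rw [mem_iff] at g
        tauto
      · by_cases m1 : u ∈ R₁.verts
        · by_cases m2 : u ∈ R₂.verts
          · rw [h.data₁.sgn_of_mem m1, h.data₂.sgn_of_mem m2, h.data₁.comp_of_mem m1,
              h.data₂.comp_of_mem m2, mem_iff, mem_iff]
            simp [hu, huv]
          · have n2 : u ∉ h.data₂.diagram.verts := fun g =>
              ((mem_iff _).1 g).elim hu fun e => m2 e.1
            exact iff_of_true (fun _ g => absurd g n2) (fun _ g => absurd g m2)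
        · have n1 : u ∉ h.data₁.diagram.verts := fun g =>
            ((mem_iff _).1 g).elim hu fun e => m1 e.1
          exact iff_of_true (fun g => absurd g n1) (fun g => absurd g m1)

theorem isStabWith_iff (h : CommonStab R₁ R₂ s v x y) {t1 t2 p1 p2 : Real.Angle} :
    IsStabWith h.data₁.diagram h.data₂.diagram t1 t2 p1 p2 ↔ IsStabWith R₁ R₂ t1 t2 p1 p2 := by
  have c₁ := card_stabVerts h.data₁.mem h.data₁.fst h.data₁.snd
  have c₂ := card_stabVerts h.data₂.mem h.data₂.fst h.data₂.snd
  unfold IsStabWith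
  rw [h.isElemMoveWith_iff, RectDiagram.stab_verts, RectDiagram.stab_verts, c₁, c₂]
  refine and_congr_right fun _ => ?_
  omega

theorem mem_iff_of_mem_corners (h : CommonStab R₁ R₂ s v x y) {t1 t2 p1 p2 : Real.Angle}
    (hm : IsElemMoveWith R₁ R₂ t1 t2 p1 p2) {u : Torus} (hu : u ∈ corners t1 t2 p1 p2) :
    u ∈ h.data₁.diagram.verts ↔ u ∈ R₁.verts :=
  h.mem_iff_of_corner (((RectDiag.isElemMoveWith_iff.1 hm).2.2.1 u).1 hu)

theorem typeICornerCond_iff (h : CommonStab R₁ R₂ s v x y) {t1 t2 p1 p2 : Real.Angle}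
    (hm : IsElemMoveWith R₁ R₂ t1 t2 p1 p2) :
    TypeICornerCond h.data₁.diagram t1 t2 p1 p2 ↔ TypeICornerCond R₁ t1 t2 p1 p2 := by
  unfold TypeICornerCond
  constructor
  · intro g u hu hc
    exact g u ((h.mem_iff_of_mem_corners hm hc).2 hu) hc
  · intro g u hu hc
    exact g u ((h.mem_iff_of_mem_corners hm hc).1 hu) hc

theorem isTypeIStab (h : CommonStab R₁ R₂ s v x y)
    (hs : IsTypeIStab h.data₁.diagram h.data₂.diagram) : IsTypeIStab R₁ R₂ := by
  obtain ⟨t1, t2, p1, p2, g1, g2⟩ := hs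
  rw [h.isStabWith_iff] at g1
  exact ⟨t1, t2, p1, p2, g1, (h.typeICornerCond_iff g1.1).1 g2⟩

theorem moveNoI (h : CommonStab R₁ R₂ s v x y) (hm : MoveNoI R₁ R₂) :
    MoveNoI h.data₁.diagram h.data₂.diagram := by
  obtain ⟨⟨t1, t2, p1, p2, hm⟩, g1, g2⟩ := hm
  exact ⟨⟨t1, t2, p1, p2, h.isElemMoveWith_iff.2 hm⟩, fun g => g1 (h.isTypeIStab g),
    fun g => g2 (h.symm.isTypeIStab g)⟩

theorem kindOk (h : CommonStab R₁ R₂ s v x y) {t : OType} {i : ℕ} (ht : t.isI = true)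
    (hk : KindOk R₁ R₂ (.stab t i)) :
    KindOk h.data₁.diagram h.data₂.diagram (.stab t i) := by
  obtain ⟨⟨t1, t2, p1, p2, hw, p0, hp0, m1, m2, hm⟩, w, hw₁, hw₂, hi⟩ := hk
  have c1 : (t1, p0) ∈ corners t1 t2 p1 p2 := mem_corners.2 ⟨Or.inl rfl, hp0⟩
  have c2 : (t2, p0) ∈ corners t1 t2 p1 p2 := mem_corners.2 ⟨Or.inr rfl, hp0⟩
  refine ⟨⟨t1, t2, p1, p2, h.isStabWith_iff.2 hw, p0, hp0,
    (h.symm.mem_iff_of_mem_corners hw.1.symm c1).2 m1,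
    (h.symm.mem_iff_of_mem_corners hw.1.symm c2).2 m2, ?_⟩,
    w, ((h.mem_and_notMem_iff w).2 ⟨hw₁, hw₂⟩).1, ((h.mem_and_notMem_iff w).2 ⟨hw₁, hw₂⟩).2, ?_⟩
  · rw [h.data₂.sgn_of_mem m2]
    cases t
    · exact ⟨(h.typeICornerCond_iff hw.1).2 hm.1, hm.2⟩
    · exact ⟨(h.typeICornerCond_iff hw.1).2 hm.1, hm.2⟩
    · exact absurd ht (by decide)
    · exact absurd ht (by decide)
  · rw [h.data₁.comp_of_mem hw₁, hi]

end CommonStab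
end Commutation

section Chains

variable {R R' A A' B : RectDiagram}

/-- Every component has a vertex that is preserved by a given elementary move. -/
theorem IsElemMove.exists_common (h : IsElemMove R A) {u : Torus} (hu : u ∈ R.verts) :
    ∃ v, v ∈ R.verts ∧ v ∈ A.verts ∧ R.comp v = R.comp u ∧ R.sgn v = A.sgn v ∧
      R.comp v = A.comp v := by
  obtain ⟨t1, t2, p1, p2, ht, hp, hs, -, -, hsub, -, hag⟩ := h
  by_contra! hcon
  have h4 := card_corners ht hp
  rw [← hs, symmDiff_def, Finset.sup_eq_union,
    Finset.card_union_of_disjoint disjoint_sdiff_sdiff] at h4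
  have h5 : 0 < (A.verts \ R.verts).card := Finset.card_pos.2 (Finset.sdiff_nonempty.2 hsub)
  have h6 : (R.verts.filter fun v => R.comp v = R.comp u) ⊆ R.verts \ A.verts := by
    intro w hw
    rw [Finset.mem_filter] at hw
    refine Finset.mem_sdiff.2 ⟨hw.1, fun hwA => ?_⟩
    obtain ⟨g1, g2⟩ := hag w (Finset.mem_inter.2 ⟨hw.1, hwA⟩)
    exact hcon w hw.1 hwA hw.2 g1 g2
  have h7 := R.four_le_card_comp hu
  have h8 := Finset.card_le_card h6
  omega

/-- `R` has a component number `i`. -/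
def HasComp (R : RectDiagram) (i : ℕ) : Prop := ∃ u ∈ R.verts, R.comp u = i

theorem HasComp.move {i : ℕ} (hi : HasComp R i) (h : IsElemMove R A) : HasComp A i := by
  obtain ⟨u, hu, rfl⟩ := hi
  obtain ⟨v, -, hv, h1, -, h2⟩ := h.exists_common hu
  exact ⟨v, hv, h2.symm.trans h1⟩

theorem HasComp.related {i : ℕ} (hi : HasComp R i) (h : Related R A) : HasComp A i := by
  induction h with
  | refl => exact hi
  | tail _ h ih => exact ih.move h.1

theorem hasComp_of_kindOk {t : OType} {i : ℕ} (h : KindOk R A (.stab t i)) : HasComp R i := by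
  obtain ⟨-, v, hv, -, hi⟩ := h
  exact ⟨v, hv, hi⟩

theorem isElemMove_of_kindOk {t : OType} {i : ℕ} (h : KindOk R A (.stab t i)) :
    IsElemMove R A := by
  obtain ⟨⟨t1, t2, p1, p2, hw, -⟩, -⟩ := h
  exact ⟨t1, t2, p1, p2, hw.1⟩

theorem exists_kindOk {t : OType} {i : ℕ} (ht : t.isI = true) (hi : HasComp R i) :
    ∃ A, KindOk R A (.stab t i) := by
  obtain ⟨v, hv, rfl⟩ := hi
  obtain ⟨s, rfl⟩ := exists_otype ht (R.sgn v)
  obtain ⟨c, d, h⟩ := exists_stabData s hv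
  exact ⟨_, h.kindOk⟩

/-- Given an elementary move, a stabilization of prescribed kind can be performed simultaneously
before and after it. -/
theorem IsElemMove.exists_commonStab {t : OType} {i : ℕ} (ht : t.isI = true) (hi : HasComp R i)
    (hm : IsElemMove R A) : ∃ s v x y, ∃ h : CommonStab R A s v x y,
      KindOk R h.data₁.diagram (.stab t i) ∧ KindOk A h.data₂.diagram (.stab t i) := by
  obtain ⟨u, hu, rfl⟩ := hi
  obtain ⟨v, hv, hvA, h1, h2, h3⟩ := hm.exists_common hu
  obtain ⟨s, hs⟩ := exists_otype ht (R.sgn v)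
  obtain ⟨x, y, h⟩ := RectDiag.exists_commonStab s hv hvA h2 h3
  refine ⟨s, v, x, y, h, ?_, ?_⟩
  · have := h.data₁.kindOk
    rwa [← hs, h1] at this
  · have := h.data₂.kindOk
    rwa [← h2, ← hs, ← h3, h1] at this

/-- Type I stabilizations of the same kind of related diagrams are related. -/
theorem related_of_related_of_kindOk {t : OType} {i : ℕ} (ht : t.isI = true)
    (hR : Related R R') (hA : KindOk R A (.stab t i)) (hA' : KindOk R' A' (.stab t i)) :
    Related A A' := by
  induction hR using Relation.ReflTransGen.head_induction_on generalizing A with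
  | refl => exact related_of_kindOk ht hA hA'
  | head hm _ ih =>
    obtain ⟨s, v, x, y, h, h1, h2⟩ := hm.1.exists_commonStab ht (hasComp_of_kindOk hA)
    exact (related_of_kindOk ht hA h1).trans (.head (h.moveNoI hm) (ih h2))

/-- Two consecutive type I stabilizations can be interchanged. -/
theorem exists_interchange {t t' : OType} {i i' : ℕ} (ht : t.isI = true) (ht' : t'.isI = true)
    (hA : KindOk R A (.stab t i)) (hB : KindOk A B (.stab t' i')) :
    ∃ C B', KindOk R C (.stab t' i') ∧ KindOk C B' (.stab t i) ∧ Related B B' := by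
  have hm := isElemMove_of_kindOk hA
  have hm' : IsElemMove A R := by
    obtain ⟨t1, t2, p1, p2, hm⟩ := hm
    exact ⟨t1, t2, p1, p2, hm.symm⟩
  obtain ⟨s, v, x, y, h, h1, h2⟩ :=
    hm.exists_commonStab ht' ((hasComp_of_kindOk hB).move hm')
  exact ⟨_, _, h1, h.kindOk ht hA, related_of_kindOk ht' hB h2⟩

/-- The kind of a type I stabilization. -/
def IsStabI (k : MoveKind) : Prop := ∃ t i, k = MoveKind.stab t i ∧ t.isI = true

/-- There is a chain of moves of the given kinds from one diagram to the other. -/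
def Chain : RectDiagram → List MoveKind → RectDiagram → Prop
  | R, [], A => R = A
  | R, k :: ks, A => ∃ S, KindOk R S k ∧ Chain S ks A

theorem chain_of_lChain {l : List (MoveKind × RectDiagram)} (h : LChain R l A) :
    Chain R (l.map Prod.fst) A := by
  induction l generalizing R with
  | nil => exact h
  | cons p l ih => exact ⟨p.2, h.1, ih h.2⟩

theorem Chain.related {ks : List MoveKind} (hks : ∀ k ∈ ks, IsStabI k) (hR : Related R R')
    (h : Chain R ks A) (h' : Chain R' ks A') : Related A A' := by
  induction ks generalizing R R' with
  | nil =>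
    cases h
    cases h'
    exact hR
  | cons k ks ih =>
    obtain ⟨S, h1, h2⟩ := h
    obtain ⟨S', h1', h2'⟩ := h'
    rw [List.forall_mem_cons] at hks
    obtain ⟨⟨t, i, rfl, ht⟩, hks⟩ := hks
    exact ih hks (related_of_related_of_kindOk ht hR h1 h1') h2 h2'

theorem Chain.exists_of_related {ks : List MoveKind} (hks : ∀ k ∈ ks, IsStabI k)
    (hR : Related R R') (h : Chain R ks A) : ∃ A', Chain R' ks A' := by
  induction ks generalizing R R' with
  | nil => exact ⟨R', rfl⟩
  | cons k ks ih =>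
    obtain ⟨S, h1, h2⟩ := h
    rw [List.forall_mem_cons] at hks
    obtain ⟨⟨t, i, rfl, ht⟩, hks⟩ := hks
    obtain ⟨S', h1'⟩ := exists_kindOk ht ((hasComp_of_kindOk h1).related hR)
    obtain ⟨A', h'⟩ := ih hks (related_of_related_of_kindOk ht hR h1 h1') h2
    exact ⟨A', S', h1', h'⟩

theorem Chain.exists_of_perm {ks ks' : List MoveKind} (hp : ks.Perm ks')
    (hks : ∀ k ∈ ks, IsStabI k) (h : Chain R ks A) : ∃ A', Chain R ks' A' ∧ Related A A' := by
  induction hp generalizing R A with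
  | nil => exact ⟨A, h, .refl⟩
  | cons k _ ih =>
    obtain ⟨S, h1, h2⟩ := h
    obtain ⟨A', h', hA⟩ := ih (fun k hk => hks k (List.mem_cons_of_mem _ hk)) h2
    exact ⟨A', ⟨S, h1, h'⟩, hA⟩
  | swap k k' ks =>
    obtain ⟨S, h1, T, h2, h3⟩ := h
    simp only [List.forall_mem_cons] at hks
    obtain ⟨⟨t', i', rfl, ht'⟩, ⟨t, i, rfl, ht⟩, hks⟩ := hks
    obtain ⟨C, T', g1, g2, hT⟩ := exists_interchange ht' ht h1 h2
    obtain ⟨A', h'⟩ := h3.exists_of_related hks hT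
    exact ⟨A', ⟨C, g1, T', g2, h'⟩, h3.related hks hT h'⟩
  | trans hp _ ih ih' =>
    obtain ⟨B, h1, h2⟩ := ih hks h
    obtain ⟨A', h3, h4⟩ := ih' (fun k hk => hks k (hp.mem_iff.2 hk)) h1
    exact ⟨A', h3, h2.trans h4⟩

theorem perm_of_count_eq {ks ks' : List MoveKind} (hks : ∀ k ∈ ks, IsStabI k)
    (hks' : ∀ k ∈ ks', IsStabI k)
    (hcount : ∀ t i, ks.count (MoveKind.stab t i) = ks'.count (MoveKind.stab t i)) :
    ks.Perm ks' := by
  rw [List.perm_iff_count]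
  intro k
  by_cases hk : IsStabI k
  · obtain ⟨t, i, rfl, -⟩ := hk
    exact hcount t i
  · rw [List.count_eq_zero_of_not_mem fun h => hk (hks k h),
      List.count_eq_zero_of_not_mem fun h => hk (hks' k h)]

end Chains

/-- Suppose `R₂` and `R₃` are related by a chain of elementary moves with no type I
(de)stabilizations, and `R₂'` (resp. `R₃'`) is obtained from `R₂` (resp. `R₃`) by a chain
consisting only of type I stabilizations, with the same number of stabilizations of each
oriented type on each component in the two chains. Then `R₂'` and `R₃'` are related by a
chain of elementary moves with no type I (de)stabilizations. -/
theorem stabilized_diagrams_still_related (R₂ R₃ R₂' R₃' : RectDiagram)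
    (hrel : Relation.ReflTransGen MoveNoI R₂ R₃)
    (s₂ s₃ : List (MoveKind × RectDiagram))
    (h₂ : LChain R₂ s₂ R₂') (h₃ : LChain R₃ s₃ R₃')
    (hstab₂ : ∀ p ∈ s₂, ∃ t i, p.1 = MoveKind.stab t i ∧ t.isI = true)
    (hstab₃ : ∀ p ∈ s₃, ∃ t i, p.1 = MoveKind.stab t i ∧ t.isI = true)
    (hcount : ∀ (t : OType) (i : ℕ),
      (s₂.map Prod.fst).count (MoveKind.stab t i) =
        (s₃.map Prod.fst).count (MoveKind.stab t i)) :
    Relation.ReflTransGen MoveNoI R₂' R₃' := by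
  have k₂ : ∀ k ∈ s₂.map Prod.fst, IsStabI k := List.forall_mem_map.2 hstab₂
  have k₃ : ∀ k ∈ s₃.map Prod.fst, IsStabI k := List.forall_mem_map.2 hstab₃
  obtain ⟨A, hA, hrelA⟩ :=
    (chain_of_lChain h₂).exists_of_perm (perm_of_count_eq k₂ k₃ hcount) k₂
  exact hrelA.trans (hA.related k₃ hrel (chain_of_lChain h₃))

end RectDiag
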